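/- arXiv:1512.02600 — 2 statements merged into one kernel-verified Lean document; each statement's English description precedes it below -/
import Mathlib

section
/- There is a constant C ≥ 1 depending only on the doubling constant C_d and the Poincaré constants C_P, λ such that for every set G ⊂ X, the 1-fine closure G̅¹ of G (the smallest 1-finely closed set containing G) satisfies cap₁(G̅¹) ≤ C cap₁(G). -/
open MeasureTheory Metric Set Filter Topology ENNReal NNReal

noncomputable section

namespace FineBV

variable {X : Type*} [MetricSpace X] [MeasurableSpace X]

/-- `g` is an upper gradient of `u` on `Ω`: for every `1`-Lipschitz
(arclength-parametrized) curve `γ : [0, ℓ] → X` with image in `Ω`,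
`|u (γ ℓ) - u (γ 0)| ≤ ∫_0^ℓ g (γ t) dt`. -/
def IsUpperGradientOn (g : X → ℝ≥0∞) (u : X → ℝ) (Ω : Set X) : Prop :=
  Measurable g ∧
    ∀ (ℓ : ℝ), 0 ≤ ℓ → ∀ γ : ℝ → X, LipschitzOnWith 1 γ (Icc 0 ℓ) →
      (∀ t ∈ Icc (0:ℝ) ℓ, γ t ∈ Ω) →
      ENNReal.ofReal |u (γ ℓ) - u (γ 0)| ≤ ∫⁻ t in Icc (0:ℝ) ℓ, g (γ t)

/-- `g` is an upper gradient of `u` on all of `X`. -/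
def IsUpperGradient (g : X → ℝ≥0∞) (u : X → ℝ) : Prop :=
  IsUpperGradientOn g u univ

/-- The (extended) `L¹` norm. -/
def eL1Norm (μ : Measure X) (u : X → ℝ) : ℝ≥0∞ :=
  ∫⁻ x, ENNReal.ofReal |u x| ∂μ

/-- The (extended) Newtonian `N^{1,1}` norm. -/
def eN11Norm (μ : Measure X) (u : X → ℝ) : ℝ≥0∞ :=
  eL1Norm μ u + ⨅ (g : X → ℝ≥0∞) (_ : IsUpperGradient g u), ∫⁻ x, g x ∂μ

/-- Membership in the Newtonian space `N^{1,1}(X)`. -/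
def MemN11 (μ : Measure X) (u : X → ℝ) : Prop :=
  Measurable u ∧ eN11Norm μ u < ⊤

/-- The `1`-capacity of a set. -/
def capacity1 (μ : Measure X) (A : Set X) : ℝ≥0∞ :=
  ⨅ (u : X → ℝ) (_ : MemN11 μ u) (_ : ∀ x ∈ A, 1 ≤ u x), eN11Norm μ u

/-- The relative (variational) `1`-capacity of `A` with respect to `Ω`. -/
def relCapacity1 (μ : Measure X) (A Ω : Set X) : ℝ≥0∞ :=
  ⨅ (u : X → ℝ) (_ : MemN11 μ u) (g : X → ℝ≥0∞) (_ : IsUpperGradient g u)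
    (_ : ∀ x ∈ A, 1 ≤ u x) (_ : ∀ x, x ∉ Ω → u x = 0),
    ∫⁻ x in Ω, g x ∂μ

/-- `A` is `1`-thin at `x`. -/
def OneThinAt (μ : Measure X) (A : Set X) (x : X) : Prop :=
  Tendsto (fun r : ℝ =>
      ENNReal.ofReal r * relCapacity1 μ (A ∩ ball x r) (ball x (2 * r)) / μ (ball x r))
    (𝓝[>] 0) (𝓝 0)

/-- `U` is `1`-finely open. -/
def OneFinelyOpen (μ : Measure X) (U : Set X) : Prop :=
  ∀ x ∈ U, OneThinAt μ Uᶜ x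

/-- `F` is `1`-finely closed. -/
def OneFinelyClosed (μ : Measure X) (F : Set X) : Prop :=
  OneFinelyOpen μ Fᶜ

/-- The `1`-fine closure: the smallest `1`-finely closed set containing `G`. -/
def oneFineClosure (μ : Measure X) (G : Set X) : Set X :=
  ⋂₀ {F : Set X | G ⊆ F ∧ OneFinelyClosed μ F}

/-- `μ` is doubling with constant `Cd`: balls have positive finite measure and
`μ(B(x,2r)) ≤ Cd · μ(B(x,r))`. -/
def DoublingWith (μ : Measure X) (Cd : ℝ≥0) : Prop :=
  ∀ (x : X) (r : ℝ), 0 < r →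
    0 < μ (ball x r) ∧ μ (ball x (2 * r)) ≤ (Cd : ℝ≥0∞) * μ (ball x r) ∧ μ (ball x r) < ⊤

/-- `u` is Lipschitz on compact subsets of `Ω` (locally Lipschitz in `Ω`). -/
def LocLipschitzOn (u : X → ℝ) (Ω : Set X) : Prop :=
  ∀ K : Set X, K ⊆ Ω → IsCompact K → ∃ L : ℝ≥0, LipschitzOnWith L u K

/-- The total variation `‖Du‖(Ω)`. -/
def totalVariation (μ : Measure X) (u : X → ℝ) (Ω : Set X) : ℝ≥0∞ :=
  ⨅ (v : ℕ → X → ℝ) (g : ℕ → X → ℝ≥0∞)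
    (_ : ∀ i, LocLipschitzOn (v i) Ω)
    (_ : ∀ i, IsUpperGradientOn (g i) (v i) Ω)
    (_ : ∀ K : Set X, K ⊆ Ω → IsCompact K →
        Tendsto (fun i => ∫⁻ x in K, ENNReal.ofReal |v i x - u x| ∂μ) atTop (𝓝 0)),
    Filter.atTop.liminf fun i => ∫⁻ x in Ω, g i x ∂μ

/-- The perimeter `P(E,Ω) = ‖Dχ_E‖(Ω)`. -/
def perimeter (μ : Measure X) (E Ω : Set X) : ℝ≥0∞ :=
  totalVariation μ (Set.indicator E fun _ => (1 : ℝ)) Ω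

/-- `u ∈ BV(X)`. -/
def MemBV (μ : Measure X) (u : X → ℝ) : Prop :=
  Integrable u μ ∧ totalVariation μ u univ < ⊤

/-- The (extended) `BV` norm. -/
def eBVNorm (μ : Measure X) (u : X → ℝ) : ℝ≥0∞ :=
  eL1Norm μ u + totalVariation μ u univ

/-- The `(1,1)`-Poincaré inequality with constants `CP`, `lam`. -/
def PoincareIneq (μ : Measure X) (CP lam : ℝ) : Prop :=
  ∀ (x : X) (r : ℝ), 0 < r → ∀ (u : X → ℝ) (g : X → ℝ≥0∞),
    LocallyIntegrable u μ → IsUpperGradient g u →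
    (∫⁻ y in ball x r, ENNReal.ofReal |u y - ⨍ z in ball x r, u z ∂μ| ∂μ) / μ (ball x r)
      ≤ ENNReal.ofReal (CP * r) * ((∫⁻ y in ball x (lam * r), g y ∂μ) / μ (ball x (lam * r)))

/-- The restricted spherical Hausdorff content of codimension 1, at scale `R`. -/
def codimHContent (μ : Measure X) (R : ℝ) (A : Set X) : ℝ≥0∞ :=
  ⨅ (c : ℕ → X) (r : ℕ → ℝ) (_ : ∀ i, 0 < r i ∧ r i ≤ R)
    (_ : A ⊆ ⋃ i, ball (c i) (r i)),
    ∑' i, μ (ball (c i) (r i)) / ENNReal.ofReal (r i)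

/-- The codimension 1 Hausdorff measure `H(A) = lim_{R→0⁺} H_R(A)`. -/
def codimH (μ : Measure X) (A : Set X) : ℝ≥0∞ :=
  ⨆ (R : ℝ) (_ : 0 < R), codimHContent μ R A

/-- The measure-theoretic interior `I_E`. -/
def measInterior (μ : Measure X) (E : Set X) : Set X :=
  {x | Tendsto (fun r : ℝ => μ (ball x r \ E) / μ (ball x r)) (𝓝[>] 0) (𝓝 0)}

/-- The measure-theoretic boundary `∂*E`. -/
def measBoundary (μ : Measure X) (E : Set X) : Set X :=
  {x | 0 < limsup (fun r : ℝ => μ (ball x r ∩ E) / μ (ball x r)) (𝓝[>] 0) ∧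
       0 < limsup (fun r : ℝ => μ (ball x r \ E) / μ (ball x r)) (𝓝[>] 0)}

/-- The lower approximate limit `u^∧`. -/
def lowerApprox (μ : Measure X) (u : X → ℝ) (x : X) : EReal :=
  sSup {t : EReal |
    Tendsto (fun r : ℝ => μ (ball x r ∩ {y | (u y : EReal) < t}) / μ (ball x r))
      (𝓝[>] 0) (𝓝 0)}

/-- The upper approximate limit `u^∨`. -/
def upperApprox (μ : Measure X) (u : X → ℝ) (x : X) : EReal :=
  sInf {t : EReal |
    Tendsto (fun r : ℝ => μ (ball x r ∩ {y | t < (u y : EReal)}) / μ (ball x r))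
      (𝓝[>] 0) (𝓝 0)}

/-- The next jump value after the value `p` at `x`. -/
def jumpNext (μ : Measure X) (u : X → ℝ) (p : EReal) (x : X) : EReal :=
  sSup {t : EReal | ∀ δ : ℝ, 0 < δ →
    Tendsto (fun r : ℝ =>
        μ (ball x r ∩ {y | p + (δ : EReal) < (u y : EReal) ∧ (u y : EReal) < t}) /
          μ (ball x r))
      (𝓝[>] 0) (𝓝 0)}

/-- Auxiliary jump values: `jumpAux μ u (l-1)` is the `l`-th jump value for `l < n`. -/
def jumpAux (μ : Measure X) (u : X → ℝ) : ℕ → X → EReal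
  | 0 => lowerApprox μ u
  | (l + 1) => fun x =>
      if jumpAux μ u l x < upperApprox μ u x then jumpNext μ u (jumpAux μ u l x) x
      else upperApprox μ u x

/-- The jump values `u^l`, `l = 1, …, n`, with `u^1 = u^∧` and `u^n = u^∨`. -/
def jumpVal (μ : Measure X) (u : X → ℝ) (n l : ℕ) : X → EReal :=
  if l = n then upperApprox μ u else jumpAux μ u (l - 1)

/-- The extended absolute difference `|a - b|` of two extended reals, with the
convention that it is `∞` whenever exactly one of them is infinite or they are
distinct infinities, and `0` when `a = b`. -/
def eAbsDiff (a b : EReal) : ℝ≥0∞ :=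
  if a = b then 0
  else if a = ⊤ ∨ a = ⊥ ∨ b = ⊤ ∨ b = ⊥ then ⊤
  else ENNReal.ofReal |a.toReal - b.toReal|

/-- `γ` satisfies the density-bound property: for every set of finite perimeter `E`,
`H`-a.e. point of `∂*E` has lower density `≥ γ` and upper density `≤ 1 - γ`. -/
def GammaDensityProperty (μ : Measure X) (γ : ℝ) : Prop :=
  ∀ E : Set X, MeasurableSet E → perimeter μ E univ < ⊤ →
    codimH μ {x ∈ measBoundary μ E |
      ¬ (ENNReal.ofReal γ ≤
            Filter.liminf (fun r : ℝ => μ (ball x r ∩ E) / μ (ball x r)) (𝓝[>] 0) ∧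
          Filter.limsup (fun r : ℝ => μ (ball x r ∩ E) / μ (ball x r)) (𝓝[>] 0) ≤
            ENNReal.ofReal (1 - γ))} = 0

/-- `v` is a discrete convolution of `u` at scale `R` (with dilation parameter `lam`). -/
def IsDiscreteConvolution (μ : Measure X) (lam R : ℝ) (u v : X → ℝ) : Prop :=
  ∃ (c : ℕ → X) (φ : ℕ → X → ℝ),
    (∀ z : X, ∃ j, z ∈ ball (c j) R) ∧
    (∃ C₀ : ℕ, ∀ k : ℕ,
      {j : ℕ | (ball (c j) (10 * lam * R) ∩ ball (c k) (10 * lam * R)).Nonempty}.Finite ∧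
      {j : ℕ | (ball (c j) (10 * lam * R) ∩ ball (c k) (10 * lam * R)).Nonempty}.ncard ≤ C₀) ∧
    (∀ j z, 0 ≤ φ j z ∧ φ j z ≤ 1) ∧
    (∃ L : ℝ≥0, ∀ j, LipschitzWith (L * (Real.toNNReal R)⁻¹) (φ j)) ∧
    (∀ j, tsupport (φ j) ⊆ ball (c j) (2 * R)) ∧
    (∀ z : X, HasSum (fun j => φ j z) 1) ∧
    (∀ z : X, v z = ∑' j, (⨍ y in ball (c j) (5 * R), u y ∂μ) * φ j z)


theorem setLIntegral_Icc_add_right (f : ℝ → ℝ≥0∞) (a b : ℝ) :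
    ∫⁻ t in Icc 0 (b - a), f (t + a) = ∫⁻ t in Icc a b, f t := by
  have h := (measurePreserving_add_right (volume : Measure ℝ) a).setLIntegral_comp_preimage_emb
    (MeasurableEquiv.addRight a).measurableEmbedding f (Icc a b)
  rw [← h]
  simp

theorem IsUpperGradient.le_subcurve {g : X → ℝ≥0∞} {u : X → ℝ} (hg : IsUpperGradient g u)
    {ℓ : ℝ} {γ : ℝ → X} (hγ : LipschitzOnWith 1 γ (Icc 0 ℓ)) {s t : ℝ} (hs : 0 ≤ s) (hst : s ≤ t)
    (ht : t ≤ ℓ) :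
    ENNReal.ofReal |u (γ t) - u (γ s)| ≤ ∫⁻ τ in Icc s t, g (γ τ) := by
  have hL : LipschitzOnWith 1 (fun τ => γ (τ + s)) (Icc 0 (t - s)) := by
    intro x hx y hy
    refine (hγ (x := x + s) ⟨by linarith [hx.1], by linarith [hx.2]⟩ (y := y + s)
      ⟨by linarith [hy.1], by linarith [hy.2]⟩).trans ?_
    simp
  have h := hg.2 (t - s) (by linarith) _ hL (fun _ _ => mem_univ _)
  rw [setLIntegral_Icc_add_right (fun τ => g (γ τ))] at h
  simpa using h

theorem setLIntegral_Icc_add_le (f : ℝ → ℝ≥0∞) {a b c : ℝ} (hab : a ≤ b) (hbc : b ≤ c) :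
    (∫⁻ t in Icc a b, f t) + ∫⁻ t in Icc b c, f t ≤ ∫⁻ t in Icc a c, f t := by
  rw [setLIntegral_congr (Ioc_ae_eq_Icc (a := b) (b := c)).symm, ← lintegral_union measurableSet_Ioc]
  · rw [Icc_union_Ioc_eq_Icc hab hbc]
  · rw [Set.disjoint_left]
    intro x hx hy
    exact absurd hx.2 (not_le.mpr hy.1)

/-- It is enough to check the upper gradient inequality on short curves. -/
theorem IsUpperGradient.of_short {g : X → ℝ≥0∞} {u : X → ℝ} (hg : Measurable g) {ρ : ℝ}
    (hρ : 0 < ρ)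
    (h : ∀ ℓ, 0 ≤ ℓ → ℓ ≤ ρ → ∀ γ : ℝ → X, LipschitzOnWith 1 γ (Icc 0 ℓ) →
      ENNReal.ofReal |u (γ ℓ) - u (γ 0)| ≤ ∫⁻ t in Icc 0 ℓ, g (γ t)) :
    IsUpperGradient g u := by
  have key : ∀ n : ℕ, ∀ ℓ, 0 ≤ ℓ → ℓ ≤ n * ρ → ∀ γ : ℝ → X, LipschitzOnWith 1 γ (Icc 0 ℓ) →
      ENNReal.ofReal |u (γ ℓ) - u (γ 0)| ≤ ∫⁻ t in Icc 0 ℓ, g (γ t) := by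
    intro n
    induction n with
    | zero =>
      intro ℓ h0 h1 γ hγ
      obtain rfl : ℓ = 0 := le_antisymm (by simpa using h1) h0
      simp
    | succ n ih =>
      intro ℓ h0 h1 γ hγ
      push_cast at h1
      by_cases hℓ : ℓ ≤ ρ
      · exact h ℓ h0 hℓ γ hγ
      push Not at hℓ
      have h2 := ih (ℓ - ρ) (by linarith) (by linarith) γ
        (hγ.mono (Icc_subset_Icc le_rfl (by linarith)))
      have hL : LipschitzOnWith 1 (fun τ => γ (τ + (ℓ - ρ))) (Icc 0 (ℓ - (ℓ - ρ))) := by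
        intro x hx y hy
        refine (hγ (x := x + (ℓ - ρ)) ⟨by linarith [hx.1], by linarith [hx.2]⟩ (y := y + (ℓ - ρ))
          ⟨by linarith [hy.1], by linarith [hy.2]⟩).trans ?_
        simp
      have h3 := h (ℓ - (ℓ - ρ)) (by linarith) (by linarith) _ hL
      rw [setLIntegral_Icc_add_right (fun τ => g (γ τ))] at h3
      simp only [sub_add_cancel, zero_add] at h3
      calc ENNReal.ofReal |u (γ ℓ) - u (γ 0)|
          ≤ ENNReal.ofReal (|u (γ (ℓ - ρ)) - u (γ 0)| + |u (γ ℓ) - u (γ (ℓ - ρ))|) := by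
            apply ENNReal.ofReal_le_ofReal
            have := abs_add_le (u (γ (ℓ - ρ)) - u (γ 0)) (u (γ ℓ) - u (γ (ℓ - ρ)))
            rwa [sub_add_sub_comm, add_comm (u (γ (ℓ - ρ))), add_sub_add_right_eq_sub] at this
        _ ≤ _ := ENNReal.ofReal_add_le
        _ ≤ _ := add_le_add h2 h3
        _ ≤ _ := setLIntegral_Icc_add_le _ (by linarith) (by linarith)
  refine ⟨hg, fun ℓ h0 γ hγ _ => ?_⟩
  obtain ⟨n, hn⟩ := exists_nat_ge (ℓ / ρ)
  exact key n ℓ h0 (by rwa [div_le_iff₀ hρ] at hn) γ hγ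

theorem IsUpperGradient.comp_lipschitz {g : X → ℝ≥0∞} {u : X → ℝ} (hg : IsUpperGradient g u)
    {φ : ℝ → ℝ} {L : ℝ} (hL : 0 ≤ L) (hφ : ∀ s t, |φ s - φ t| ≤ L * |s - t|) :
    IsUpperGradient (fun x => ENNReal.ofReal L * g x) (fun x => φ (u x)) := by
  refine ⟨hg.1.const_mul _, fun ℓ h0 γ hγ hm => ?_⟩
  calc ENNReal.ofReal |φ (u (γ ℓ)) - φ (u (γ 0))|
      ≤ ENNReal.ofReal (L * |u (γ ℓ) - u (γ 0)|) := ENNReal.ofReal_le_ofReal (hφ _ _)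
    _ = ENNReal.ofReal L * ENNReal.ofReal |u (γ ℓ) - u (γ 0)| := ENNReal.ofReal_mul hL
    _ ≤ ENNReal.ofReal L * ∫⁻ t in Icc 0 ℓ, g (γ t) := by
        gcongr; exact hg.2 ℓ h0 γ hγ hm
    _ = _ := (lintegral_const_mul' _ _ ENNReal.ofReal_ne_top).symm

theorem isUpperGradient_const (c : ℝ) : IsUpperGradient (0 : X → ℝ≥0∞) (fun _ => c) :=
  ⟨measurable_zero, by simp⟩

theorem IsUpperGradient.continuousOn_comp {g : X → ℝ≥0∞} {u : X → ℝ} (hg : IsUpperGradient g u)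
    {ℓ : ℝ} {γ : ℝ → X} (hγ : LipschitzOnWith 1 γ (Icc 0 ℓ))
    (hfin : ∫⁻ t in Icc 0 ℓ, g (γ t) ≠ ⊤) : ContinuousOn (fun t => u (γ t)) (Icc 0 ℓ) := by
  rw [Metric.continuousOn_iff]
  intro t ht ε hε
  obtain ⟨δ, hδ, H⟩ := exists_pos_setLIntegral_lt_of_measure_lt hfin
    (ε := ENNReal.ofReal ε) (by simpa using hε)
  have key : ∀ s t, 0 ≤ s → s ≤ t → t ≤ ℓ → ENNReal.ofReal (t - s) < δ →
      |u (γ t) - u (γ s)| < ε := by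
    intro s t hs hst ht hd
    have h1 := hg.le_subcurve hγ hs hst ht
    have h2 := H (Icc s t) (by
      refine lt_of_le_of_lt (Measure.restrict_apply_le _ _) ?_
      simpa using hd)
    rw [Measure.restrict_restrict measurableSet_Icc,
      inter_eq_left.mpr (Icc_subset_Icc hs ht)] at h2
    exact (ENNReal.ofReal_lt_ofReal_iff hε).mp (h1.trans_lt h2)
  obtain ⟨η, hη, hηδ⟩ : ∃ η : ℝ, 0 < η ∧ ENNReal.ofReal η ≤ δ := by
    rcases eq_or_ne δ ⊤ with rfl | hδt
    · exact ⟨1, one_pos, le_top⟩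
    · exact ⟨δ.toReal, ENNReal.toReal_pos hδ.ne' hδt, ENNReal.ofReal_toReal_le⟩
  refine ⟨η, hη, fun s hs hd => ?_⟩
  rw [Real.dist_eq] at hd ⊢
  rcases le_total s t with hst | hst
  · rw [abs_sub_comm]
    refine key s t hs.1 hst ht.2 (lt_of_lt_of_le ?_ hηδ)
    rw [ENNReal.ofReal_lt_ofReal_iff hη]
    rw [abs_lt] at hd; linarith
  · refine key t s ht.1 hst hs.2 (lt_of_lt_of_le ?_ hηδ)
    rw [ENNReal.ofReal_lt_ofReal_iff hη]
    rw [abs_lt] at hd; linarith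

/-- A continuous function crossing from `≤ p` to `≥ q` has an excursion inside `(p, q)`. -/
theorem exists_crossing {f : ℝ → ℝ} {ℓ p q : ℝ} (hℓ : 0 ≤ ℓ) (hf : ContinuousOn f (Icc 0 ℓ))
    (h0 : f 0 ≤ p) (h1 : q ≤ f ℓ) :
    ∃ α β, 0 ≤ α ∧ α ≤ β ∧ β ≤ ℓ ∧ f α ≤ p ∧ q ≤ f β ∧ ∀ t ∈ Ioo α β, p < f t ∧ f t < q := by
  have hS : IsCompact (Icc 0 ℓ ∩ f ⁻¹' Ici q) :=
    isCompact_Icc.of_isClosed_subset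
      (hf.preimage_isClosed_of_isClosed isClosed_Icc isClosed_Ici) inter_subset_left
  obtain ⟨β, hβ, hβm⟩ := hS.exists_isLeast ⟨ℓ, ⟨hℓ, le_rfl⟩, h1⟩
  have hf' : ContinuousOn f (Icc 0 β) := hf.mono (Icc_subset_Icc le_rfl hβ.1.2)
  have hT : IsCompact (Icc 0 β ∩ f ⁻¹' Iic p) :=
    isCompact_Icc.of_isClosed_subset
      (hf'.preimage_isClosed_of_isClosed isClosed_Icc isClosed_Iic) inter_subset_left
  obtain ⟨α, hα, hαm⟩ := hT.exists_isGreatest ⟨0, ⟨le_rfl, hβ.1.1⟩, h0⟩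
  refine ⟨α, β, hα.1.1, hα.1.2, hβ.1.2, hα.2, hβ.2, fun t ht => ⟨?_, ?_⟩⟩
  · by_contra! hc
    exact absurd (hαm ⟨⟨hα.1.1.trans ht.1.le, ht.2.le⟩, hc⟩) (not_le.mpr ht.1)
  · by_contra! hc
    exact absurd (hβm ⟨⟨hα.1.1.trans ht.1.le, ht.2.le.trans hβ.1.2⟩, hc⟩) (not_le.mpr ht.2)

/-- The gradient of a truncation is carried, up to an arbitrarily small multiple of `g`, by the
level strip. -/
theorem IsUpperGradient.truncate {g : X → ℝ≥0∞} {u : X → ℝ} (hg : IsUpperGradient g u)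
    (hu : Measurable u) {s t : ℝ} (hst : s ≤ t) {δ : ℝ≥0∞} (hδ : δ ≠ 0) :
    IsUpperGradient (fun x => {y | s < u y ∧ u y < t}.indicator g x + δ * g x)
      (fun x => max s (min (u x) t)) := by
  have hE : MeasurableSet {y | s < u y ∧ u y < t} :=
    (measurableSet_lt measurable_const hu).inter (measurableSet_lt hu measurable_const)
  refine ⟨(hg.1.indicator hE).add (hg.1.const_mul _), fun ℓ h0 γ hγ hm => ?_⟩
  by_cases hfin : ∫⁻ τ in Icc 0 ℓ, g (γ τ) = ⊤
  · refine le_top.trans (le_of_eq ?_)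
    symm
    rw [eq_top_iff]
    calc (⊤ : ℝ≥0∞) = δ * ⊤ := (ENNReal.mul_top hδ).symm
      _ ≤ ∫⁻ τ in Icc 0 ℓ, δ * g (γ τ) := by rw [← hfin]; exact lintegral_const_mul_le _ _
      _ ≤ _ := lintegral_mono fun _ => le_add_self
  have hc := hg.continuousOn_comp hγ hfin
  have main : ∀ α β : ℝ, 0 ≤ α → α ≤ β → β ≤ ℓ → (∀ τ ∈ Ioo α β, s < u (γ τ) ∧ u (γ τ) < t) →
      ENNReal.ofReal |u (γ β) - u (γ α)| ≤
        ∫⁻ τ in Icc 0 ℓ, ({y | s < u y ∧ u y < t}.indicator g (γ τ) + δ * g (γ τ)) := by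
    intro α β hα hαβ hβ H
    refine (hg.le_subcurve hγ hα hαβ hβ).trans ?_
    rw [setLIntegral_congr (Ioo_ae_eq_Icc (a := α) (b := β)).symm]
    refine (setLIntegral_mono' measurableSet_Ioo (g := fun τ =>
      {y | s < u y ∧ u y < t}.indicator g (γ τ) + δ * g (γ τ)) ?_).trans
      (lintegral_mono_set (Ioo_subset_Icc_self.trans (Icc_subset_Icc hα hβ)))
    intro τ hτ
    rw [indicator_of_mem (show γ τ ∈ {y | s < u y ∧ u y < t} from H τ hτ)]
    exact le_self_add
  rcases lt_trichotomy (max s (min (u (γ 0)) t)) (max s (min (u (γ ℓ)) t)) with h | h | h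
  · obtain ⟨α, β, hα, hαβ, hβ, hfα, hfβ, H⟩ := exists_crossing h0 hc
      (p := max s (min (u (γ 0)) t)) (q := max s (min (u (γ ℓ)) t))
      (by
        by_contra! hcon
        have hle := hcon
        rw [max_lt_iff, min_lt_iff] at hle
        have : max s (min (u (γ ℓ)) t) ≤ t := max_le hst (min_le_right _ _)
        rcases hle.2 with h' | h'
        · linarith
        · rw [min_eq_right h'.le] at h
          linarith [le_max_right s t])
      (by
        by_contra! hcon
        rw [lt_max_iff, lt_min_iff] at hcon
        have : s ≤ max s (min (u (γ 0)) t) := le_max_left _ _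
        rcases hcon with h' | h'
        · have : max s (min (u (γ ℓ)) t) ≤ s := max_le le_rfl ((min_le_left _ _).trans h'.le)
          linarith
        · linarith)
    refine le_trans (ENNReal.ofReal_le_ofReal ?_) (main α β hα hαβ hβ fun τ hτ =>
      ⟨(le_max_left _ _).trans_lt (H τ hτ).1, (H τ hτ).2.trans_le (max_le hst (min_le_right _ _))⟩)
    rw [abs_of_pos (by linarith), abs_of_pos (by linarith)]
    linarith
  · simp [h]
  · obtain ⟨α, β, hα, hαβ, hβ, hfα, hfβ, H⟩ := exists_crossing (f := fun t => - u (γ t)) h0 hc.neg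
      (p := -max s (min (u (γ 0)) t)) (q := -max s (min (u (γ ℓ)) t))
      (by
        by_contra! hcon
        rw [neg_lt_neg_iff, lt_max_iff, lt_min_iff] at hcon
        have : s ≤ max s (min (u (γ ℓ)) t) := le_max_left _ _
        rcases hcon with h' | h'
        · have : max s (min (u (γ 0)) t) ≤ s := max_le le_rfl ((min_le_left _ _).trans h'.le)
          linarith
        · linarith)
      (by
        by_contra! hcon
        rw [neg_lt_neg_iff, max_lt_iff, min_lt_iff] at hcon
        have : max s (min (u (γ 0)) t) ≤ t := max_le hst (min_le_right _ _)
        rcases hcon.2 with h' | h'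
        · linarith
        · rw [min_eq_right h'.le] at h
          linarith [le_max_right s t])
    refine le_trans (ENNReal.ofReal_le_ofReal ?_) (main α β hα hαβ hβ fun τ hτ => ?_)
    · rw [abs_of_neg (by linarith), abs_of_neg (by linarith)]
      linarith
    · have h1 := H τ hτ
      simp only [neg_lt_neg_iff] at h1
      exact ⟨(le_max_left _ _).trans_lt h1.2, h1.1.trans_le (max_le hst (min_le_right _ _))⟩

/-- The `1/R`-Lipschitz cutoff which is `1` on `ball c R` and `0` off `ball c (2 * R)`. -/
def cutoff (c : X) (R : ℝ) (y : X) : ℝ := max 0 (min 1 (2 - dist y c / R))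

theorem cutoff_nonneg {X : Type*} [MetricSpace X] (c : X) (R : ℝ) (y : X) :
    0 ≤ cutoff c R y := le_max_left _ _

theorem cutoff_le_one {X : Type*} [MetricSpace X] (c : X) (R : ℝ) (y : X) : cutoff c R y ≤ 1 :=
  max_le zero_le_one (min_le_left _ _)

theorem cutoff_eq_one {X : Type*} [MetricSpace X] {c : X} {R : ℝ} (hR : 0 < R) {y : X}
    (hy : y ∈ ball c R) :
    cutoff c R y = 1 := by
  have : dist y c / R ≤ 1 := (div_le_one hR).mpr (mem_ball.mp hy).le
  rw [cutoff, min_eq_left (by linarith), max_eq_right zero_le_one]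

theorem cutoff_eq_zero {X : Type*} [MetricSpace X] {c : X} {R : ℝ} (hR : 0 < R) {y : X}
    (hy : y ∉ ball c (2 * R)) :
    cutoff c R y = 0 := by
  have : 2 ≤ dist y c / R := by
    rw [le_div_iff₀ hR]
    simpa using hy
  rw [cutoff, max_eq_left]
  exact (min_le_right _ _).trans (by linarith)

theorem abs_cutoff_sub_le {X : Type*} [MetricSpace X] (c : X) {R : ℝ} (hR : 0 < R) (y z : X) :
    |cutoff c R y - cutoff c R z| ≤ dist y z / R := by
  unfold cutoff
  refine (abs_max_sub_max_le_max _ _ _ _).trans ?_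
  rw [sub_self, abs_zero, max_eq_right (abs_nonneg _)]
  refine (abs_min_sub_min_le_max _ _ _ _).trans ?_
  rw [sub_self, abs_zero, max_eq_right (abs_nonneg _)]
  rw [show 2 - dist y c / R - (2 - dist z c / R) = (dist z c - dist y c) / R by ring, abs_div,
    abs_of_pos hR, abs_sub_comm]
  gcongr
  exact abs_dist_sub_le y z c

theorem measurable_cutoff [OpensMeasurableSpace X] (c : X) (R : ℝ) :
    Measurable (cutoff c R) := by
  unfold cutoff
  have : Continuous fun y : X => max 0 (min 1 (2 - dist y c / R)) := by fun_prop
  exact this.measurable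

theorem IsUpperGradient.mul_cutoff [OpensMeasurableSpace X] {g : X → ℝ≥0∞} {w : X → ℝ}
    (hg : IsUpperGradient g w) (hw : Measurable w) (hw0 : ∀ y, 0 ≤ w y) (c : X) {R : ℝ}
    (hR : 0 < R) :
    IsUpperGradient ((ball c (3 * R)).indicator fun y => 2 * g y + ENNReal.ofReal (w y / R))
      (fun y => w y * cutoff c R y) := by
  refine IsUpperGradient.of_short
    (((hg.1.const_mul _).add (hw.div_const _).ennreal_ofReal).indicator measurableSet_ball) hR ?_
  intro ℓ h0 hℓ γ hγ
  by_cases hout : γ 0 ∉ ball c (2 * R) ∧ γ ℓ ∉ ball c (2 * R)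
  · rw [cutoff_eq_zero hR hout.1, cutoff_eq_zero hR hout.2]
    simp
  have hdist : ∀ s ∈ Icc 0 ℓ, ∀ t ∈ Icc 0 ℓ, dist (γ s) (γ t) ≤ ℓ := by
    intro s hs t ht
    have h1 := hγ.dist_le_mul s hs t ht
    rw [NNReal.coe_one, one_mul, Real.dist_eq] at h1
    exact h1.trans (abs_le.mpr ⟨by linarith [hs.1, ht.2], by linarith [hs.2, ht.1]⟩)
  have hm0 : (0 : ℝ) ∈ Icc 0 ℓ := ⟨le_rfl, h0⟩
  have hmℓ : ℓ ∈ Icc 0 ℓ := ⟨h0, le_rfl⟩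
  have hin : ∀ t ∈ Icc 0 ℓ, γ t ∈ ball c (3 * R) := by
    intro t ht
    rw [not_and_or, not_not, not_not] at hout
    rw [mem_ball]
    rcases hout with h | h
    · have := dist_triangle (γ t) (γ 0) c
      linarith [hdist t ht 0 hm0, mem_ball.mp h]
    · have := dist_triangle (γ t) (γ ℓ) c
      linarith [hdist t ht ℓ hmℓ, mem_ball.mp h]
  have hcongr : ∫⁻ t in Icc 0 ℓ,
      (ball c (3 * R)).indicator (fun y => 2 * g y + ENNReal.ofReal (w y / R)) (γ t) =
      ∫⁻ t in Icc 0 ℓ, (2 * g (γ t) + ENNReal.ofReal (w (γ t) / R)) := by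
    refine setLIntegral_congr_fun measurableSet_Icc fun t ht => ?_
    exact indicator_of_mem (hin t ht) _
  rw [hcongr]
  set G : ℝ≥0∞ := ∫⁻ t in Icc 0 ℓ, g (γ t) with hG
  have hpt : ∀ τ ∈ Icc 0 ℓ, ENNReal.ofReal (w (γ 0) / R) ≤
      ENNReal.ofReal (w (γ τ) / R) + G / ENNReal.ofReal R := by
    intro τ hτ
    have h1 : ENNReal.ofReal |w (γ τ) - w (γ 0)| ≤ G :=
      (hg.le_subcurve hγ le_rfl hτ.1 hτ.2).trans
        (lintegral_mono_set (Icc_subset_Icc le_rfl hτ.2))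
    have h2 : w (γ 0) ≤ w (γ τ) + |w (γ τ) - w (γ 0)| := by
      linarith [neg_abs_le (w (γ τ) - w (γ 0))]
    rw [ENNReal.ofReal_div_of_pos hR, ENNReal.ofReal_div_of_pos hR, ← ENNReal.add_div]
    gcongr
    exact (ENNReal.ofReal_le_ofReal h2).trans (ENNReal.ofReal_add_le.trans (by gcongr))
  have hw0' : ENNReal.ofReal (w (γ 0) * (ℓ / R)) ≤
      (∫⁻ t in Icc 0 ℓ, ENNReal.ofReal (w (γ t) / R)) + G := by
    calc ENNReal.ofReal (w (γ 0) * (ℓ / R))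
        = ∫⁻ _ in Icc 0 ℓ, ENNReal.ofReal (w (γ 0) / R) := by
          rw [setLIntegral_const, Real.volume_Icc, sub_zero,
            ← ENNReal.ofReal_mul (div_nonneg (hw0 _) hR.le)]
          congr 1; ring
      _ ≤ ∫⁻ t in Icc 0 ℓ, (ENNReal.ofReal (w (γ t) / R) + G / ENNReal.ofReal R) :=
          setLIntegral_mono' measurableSet_Icc hpt
      _ = (∫⁻ t in Icc 0 ℓ, ENNReal.ofReal (w (γ t) / R)) +
            G / ENNReal.ofReal R * ENNReal.ofReal ℓ := by
          rw [lintegral_add_right _ measurable_const, setLIntegral_const, Real.volume_Icc, sub_zero]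
      _ ≤ _ := by
          gcongr
          calc G / ENNReal.ofReal R * ENNReal.ofReal ℓ
              ≤ G / ENNReal.ofReal R * ENNReal.ofReal R := by gcongr
            _ ≤ G := (ENNReal.div_mul_cancel (by simpa using hR) ENNReal.ofReal_ne_top).le
  have habs : |w (γ ℓ) * cutoff c R (γ ℓ) - w (γ 0) * cutoff c R (γ 0)| ≤
      |w (γ ℓ) - w (γ 0)| + w (γ 0) * (ℓ / R) := by
    rw [show w (γ ℓ) * cutoff c R (γ ℓ) - w (γ 0) * cutoff c R (γ 0) =
      (w (γ ℓ) - w (γ 0)) * cutoff c R (γ ℓ) +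
        w (γ 0) * (cutoff c R (γ ℓ) - cutoff c R (γ 0)) by ring]
    refine (abs_add_le _ _).trans (add_le_add ?_ ?_)
    · rw [abs_mul, abs_of_nonneg (cutoff_nonneg _ _ _)]
      exact mul_le_of_le_one_right (abs_nonneg _) (cutoff_le_one _ _ _)
    · rw [abs_mul, abs_of_nonneg (hw0 _)]
      refine mul_le_mul_of_nonneg_left ((abs_cutoff_sub_le c hR _ _).trans ?_) (hw0 _)
      gcongr
      exact hdist ℓ hmℓ 0 hm0
  calc ENNReal.ofReal |w (γ ℓ) * cutoff c R (γ ℓ) - w (γ 0) * cutoff c R (γ 0)|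
      ≤ ENNReal.ofReal |w (γ ℓ) - w (γ 0)| + ENNReal.ofReal (w (γ 0) * (ℓ / R)) :=
        (ENNReal.ofReal_le_ofReal habs).trans ENNReal.ofReal_add_le
    _ ≤ G + ((∫⁻ t in Icc 0 ℓ, ENNReal.ofReal (w (γ t) / R)) + G) :=
        add_le_add (hg.2 ℓ h0 γ hγ (fun _ _ => mem_univ _)) hw0'
    _ = 2 * G + ∫⁻ t in Icc 0 ℓ, ENNReal.ofReal (w (γ t) / R) := by ring
    _ ≤ (∫⁻ t in Icc 0 ℓ, 2 * g (γ t)) + ∫⁻ t in Icc 0 ℓ, ENNReal.ofReal (w (γ t) / R) := by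
        gcongr; exact lintegral_const_mul_le _ _
    _ ≤ _ := le_lintegral_add _ _

theorem IsUpperGradient.add {g g' : X → ℝ≥0∞} {u v : X → ℝ} (hg : IsUpperGradient g u)
    (hg' : IsUpperGradient g' v) : IsUpperGradient (g + g') (u + v) := by
  refine ⟨hg.1.add hg'.1, fun ℓ h0 γ hγ hm => ?_⟩
  calc ENNReal.ofReal |(u + v) (γ ℓ) - (u + v) (γ 0)|
      ≤ ENNReal.ofReal (|u (γ ℓ) - u (γ 0)| + |v (γ ℓ) - v (γ 0)|) := by
        apply ENNReal.ofReal_le_ofReal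
        have := abs_add_le (u (γ ℓ) - u (γ 0)) (v (γ ℓ) - v (γ 0))
        rwa [sub_add_sub_comm] at this
    _ ≤ _ := ENNReal.ofReal_add_le
    _ ≤ _ := add_le_add (hg.2 ℓ h0 γ hγ hm) (hg'.2 ℓ h0 γ hγ hm)
    _ ≤ _ := le_lintegral_add _ _

theorem eN11Norm_le (μ : Measure X) {g : X → ℝ≥0∞} {u : X → ℝ} (hg : IsUpperGradient g u) :
    eN11Norm μ u ≤ eL1Norm μ u + ∫⁻ x, g x ∂μ :=
  add_le_add le_rfl (iInf₂_le g hg)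

theorem capacity1_le (μ : Measure X) {A : Set X} {g : X → ℝ≥0∞} {u : X → ℝ} (hu : Measurable u)
    (hg : IsUpperGradient g u) (hA : ∀ x ∈ A, 1 ≤ u x) :
    capacity1 μ A ≤ eL1Norm μ u + ∫⁻ x, g x ∂μ := by
  rcases eq_or_ne (eL1Norm μ u + ∫⁻ x, g x ∂μ) ⊤ with h | h
  · rw [h]; exact le_top
  · exact (iInf_le_of_le u (iInf₂_le ⟨hu, (eN11Norm_le μ hg).trans_lt h.lt_top⟩ hA)).trans
      (eN11Norm_le μ hg)

theorem capacity1_mono (μ : Measure X) {A B : Set X} (h : A ⊆ B) :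
    capacity1 μ A ≤ capacity1 μ B :=
  iInf_mono fun _ => iInf_mono fun _ => le_iInf fun hB => iInf_le _ fun x hx => hB x (h hx)

theorem exists_upperGradient_of_eN11Norm_lt {μ : Measure X} {u : X → ℝ} {c : ℝ≥0∞}
    (h : eN11Norm μ u < c) : ∃ g, IsUpperGradient g u ∧ eL1Norm μ u + ∫⁻ x, g x ∂μ < c := by
  rw [eN11Norm, ← lt_tsub_iff_left] at h
  obtain ⟨g, hg⟩ := iInf_lt_iff.mp h
  obtain ⟨hg1, hg2⟩ := iInf_lt_iff.mp hg
  exact ⟨g, hg1, lt_tsub_iff_left.mp hg2⟩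

theorem exists_capacity_test {μ : Measure X} {A : Set X} {c : ℝ≥0∞} (h : capacity1 μ A < c) :
    ∃ (v : X → ℝ) (g : X → ℝ≥0∞), Measurable v ∧ IsUpperGradient g v ∧ (∀ x, 0 ≤ v x) ∧
      (∀ x, v x ≤ 1) ∧ (∀ x ∈ A, 1 ≤ v x) ∧ eL1Norm μ v + ∫⁻ x, g x ∂μ < c := by
  obtain ⟨u, h1⟩ := iInf_lt_iff.mp h
  obtain ⟨hu, h2⟩ := iInf_lt_iff.mp h1
  obtain ⟨hA, h3⟩ := iInf_lt_iff.mp h2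
  obtain ⟨g, hg, h4⟩ := exists_upperGradient_of_eN11Norm_lt h3
  have hL : ∀ s t : ℝ, |min |s| 1 - min |t| 1| ≤ 1 * |s - t| := by
    intro s t
    refine (abs_min_sub_min_le_max _ _ _ _).trans ?_
    rw [sub_self, abs_zero, max_eq_left (abs_nonneg _), one_mul]
    exact abs_abs_sub_abs_le_abs_sub s t
  refine ⟨fun x => min |u x| 1, g, (hu.1.abs).min measurable_const, ?_, fun x => by positivity,
    fun x => min_le_right _ _, fun x hx => le_min ((hA x hx).trans (le_abs_self _)) le_rfl, ?_⟩
  · simpa using hg.comp_lipschitz zero_le_one hL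
  · refine lt_of_le_of_lt (add_le_add ?_ le_rfl) h4
    refine lintegral_mono fun x => ENNReal.ofReal_le_ofReal ?_
    rw [abs_of_nonneg (by positivity)]
    exact min_le_left _ _

theorem ofReal_abs_toReal_sub_le {a b S : ℝ≥0∞} (ha : a ≠ ⊤) (hb : b ≠ ⊤) (h1 : a ≤ b + S)
    (h2 : b ≤ a + S) : ENNReal.ofReal |a.toReal - b.toReal| ≤ S := by
  rcases eq_or_ne S ⊤ with rfl | hS
  · exact le_top
  refine ENNReal.ofReal_le_of_le_toReal (abs_le.mpr ⟨?_, ?_⟩)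
  · have := ENNReal.toReal_mono (by finiteness) h2
    rw [ENNReal.toReal_add ha hS] at this
    linarith
  · have := ENNReal.toReal_mono (by finiteness) h1
    rw [ENNReal.toReal_add hb hS] at this
    linarith

theorem capacity1_iUnion_le [BorelSpace X] (μ : Measure X) {ι : Type*} [Countable ι]
    (A : ι → Set X) : capacity1 μ (⋃ i, A i) ≤ ∑' i, capacity1 μ (A i) := by
  rcases eq_or_ne (∑' i, capacity1 μ (A i)) ⊤ with htop | htop
  · rw [htop]; exact le_top
  refine ENNReal.le_of_forall_pos_le_add fun ε hε _ => ?_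
  obtain ⟨ε', hε', hsum⟩ := ENNReal.exists_pos_sum_of_countable (ENNReal.coe_pos.mpr hε).ne' ι
  have hfin : ∀ i, capacity1 μ (A i) < capacity1 μ (A i) + ε' i := fun i =>
    ENNReal.lt_add_right (ENNReal.ne_top_of_tsum_ne_top htop i) (by simpa using (hε' i).ne')
  choose v g hv hg hv0 hv1 hA hlt using fun i => exists_capacity_test (hfin i)
  have hle1 : ∀ x, (⨆ i, ENNReal.ofReal (v i x)) ≤ 1 := fun x =>
    iSup_le fun i => by simpa using hv1 i x
  have hne : ∀ x, (⨆ i, ENNReal.ofReal (v i x)) ≠ ⊤ := fun x =>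
    ((hle1 x).trans_lt ENNReal.one_lt_top).ne
  have hUG : IsUpperGradient (fun x => ∑' i, g i x)
      (fun x => (⨆ i, ENNReal.ofReal (v i x)).toReal) := by
    refine ⟨Measurable.tsum fun i => (hg i).1, fun ℓ h0 γ hγ hm => ?_⟩
    have hswap := lintegral_tsum (μ := volume.restrict (Icc 0 ℓ)) (f := fun i t => g i (γ t))
      fun i => (hg i).1.comp_aemeasurable (hγ.continuousOn.aemeasurable measurableSet_Icc)
    beta_reduce
    rw [hswap]
    have hstep : ∀ i, ENNReal.ofReal |v i (γ ℓ) - v i (γ 0)| ≤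
        ∑' i, ∫⁻ t in Icc 0 ℓ, g i (γ t) := fun i =>
      ((hg i).2 ℓ h0 γ hγ hm).trans (ENNReal.le_tsum i)
    refine ofReal_abs_toReal_sub_le (hne _) (hne _) ?_ ?_
    · refine iSup_le fun i => ?_
      refine (ENNReal.ofReal_le_ofReal (q := v i (γ 0) + |v i (γ ℓ) - v i (γ 0)|) ?_).trans
        (ENNReal.ofReal_add_le.trans (add_le_add (le_iSup (fun i => ENNReal.ofReal (v i (γ 0))) i)
          (hstep i)))
      linarith [le_abs_self (v i (γ ℓ) - v i (γ 0))]
    · refine iSup_le fun i => ?_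
      refine (ENNReal.ofReal_le_ofReal (q := v i (γ ℓ) + |v i (γ ℓ) - v i (γ 0)|) ?_).trans
        (ENNReal.ofReal_add_le.trans (add_le_add (le_iSup (fun i => ENNReal.ofReal (v i (γ ℓ))) i)
          (hstep i)))
      linarith [neg_abs_le (v i (γ ℓ) - v i (γ 0))]
  have hmeas : Measurable fun x => (⨆ i, ENNReal.ofReal (v i x)).toReal :=
    (Measurable.iSup fun i => (hv i).ennreal_ofReal).ennreal_toReal
  refine (capacity1_le μ hmeas hUG ?_).trans ?_
  · intro x hx
    obtain ⟨i, hi⟩ := mem_iUnion.mp hx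
    have h1 : (1 : ℝ≥0∞) ≤ ⨆ i, ENNReal.ofReal (v i x) :=
      le_iSup_of_le i (by simpa using hA i x hi)
    simpa using ENNReal.toReal_mono (hne x) h1
  · calc eL1Norm μ (fun x => (⨆ i, ENNReal.ofReal (v i x)).toReal) + ∫⁻ x, ∑' i, g i x ∂μ
        ≤ (∫⁻ x, ∑' i, ENNReal.ofReal |v i x| ∂μ) + ∫⁻ x, ∑' i, g i x ∂μ := by
          gcongr
          refine lintegral_mono fun x => ?_
          rw [abs_of_nonneg ENNReal.toReal_nonneg, ENNReal.ofReal_toReal (hne x)]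
          refine iSup_le fun i => ?_
          refine le_trans ?_ (ENNReal.le_tsum i)
          exact ENNReal.ofReal_le_ofReal (le_abs_self _)
      _ = (∑' i, ∫⁻ x, ENNReal.ofReal |v i x| ∂μ) + ∑' i, ∫⁻ x, g i x ∂μ := by
          rw [lintegral_tsum fun i => (hv i).abs.ennreal_ofReal.aemeasurable,
            lintegral_tsum fun i => (hg i).1.aemeasurable]
      _ = ∑' i, (eL1Norm μ (v i) + ∫⁻ x, g i x ∂μ) := ENNReal.tsum_add.symm
      _ ≤ ∑' i, (capacity1 μ (A i) + ε' i) := ENNReal.tsum_le_tsum fun i => (hlt i).le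
      _ = (∑' i, capacity1 μ (A i)) + ∑' i, (ε' i : ℝ≥0∞) := ENNReal.tsum_add
      _ ≤ _ := by gcongr

theorem capacity1_union_le [BorelSpace X] (μ : Measure X) (A B : Set X) :
    capacity1 μ (A ∪ B) ≤ capacity1 μ A + capacity1 μ B := by
  rw [union_eq_iUnion]
  refine (capacity1_iUnion_le μ _).trans (le_of_eq ?_)
  rw [tsum_bool, add_comm]
  rfl

theorem capacity1_iUnion_eq_zero [BorelSpace X] {μ : Measure X} {ι : Type*} [Countable ι]
    {A : ι → Set X} (h : ∀ i, capacity1 μ (A i) = 0) : capacity1 μ (⋃ i, A i) = 0 := by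
  have := capacity1_iUnion_le μ A
  simpa [h] using this

/-- Capacity of the part of `A` in a ball, through a cut-off test function. -/
theorem capacity1_inter_ball_le [OpensMeasurableSpace X] (μ : Measure X) {A : Set X}
    {g : X → ℝ≥0∞} {w : X → ℝ} (hw : Measurable w) (hg : IsUpperGradient g w)
    (hw0 : ∀ x, 0 ≤ w x) (hA : ∀ x ∈ A, 1 ≤ w x) (c : X) {R : ℝ} (hR : 0 < R) :
    capacity1 μ (A ∩ ball c R) ≤ 2 * (∫⁻ x in ball c (3 * R), g x ∂μ) +
      (1 + ENNReal.ofReal R⁻¹) * ∫⁻ x in ball c (3 * R), ENNReal.ofReal (w x) ∂μ := by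
  refine (capacity1_le μ (u := fun x => w x * cutoff c R x)
    (hw.mul (measurable_cutoff c R)) (hg.mul_cutoff hw hw0 c hR)
    fun x hx => ?_).trans ?_
  · rw [cutoff_eq_one hR hx.2, mul_one]
    exact hA x hx.1
  rw [lintegral_indicator measurableSet_ball, lintegral_add_left (hg.1.const_mul _),
    lintegral_const_mul _ hg.1]
  have h1 : eL1Norm μ (fun x => w x * cutoff c R x) ≤
      ∫⁻ x in ball c (3 * R), ENNReal.ofReal (w x) ∂μ := by
    rw [← lintegral_indicator measurableSet_ball]
    refine lintegral_mono fun x => ?_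
    by_cases hx : x ∈ ball c (3 * R)
    · rw [indicator_of_mem hx, abs_of_nonneg (mul_nonneg (hw0 x) (cutoff_nonneg _ _ _))]
      exact ENNReal.ofReal_le_ofReal (mul_le_of_le_one_right (hw0 x) (cutoff_le_one _ _ _))
    · have : cutoff c R x = 0 :=
        cutoff_eq_zero hR fun h => hx (ball_subset_ball (by linarith) h)
      simp [this]
  have h2 : ∫⁻ x in ball c (3 * R), ENNReal.ofReal (w x / R) ∂μ =
      ENNReal.ofReal R⁻¹ * ∫⁻ x in ball c (3 * R), ENNReal.ofReal (w x) ∂μ := by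
    rw [← lintegral_const_mul _ hw.ennreal_ofReal]
    refine lintegral_congr fun x => ?_
    rw [← ENNReal.ofReal_mul (by positivity), div_eq_inv_mul]
  rw [h2, add_mul, one_mul]
  calc _ ≤ (∫⁻ x in ball c (3 * R), ENNReal.ofReal (w x) ∂μ) + _ := add_le_add h1 le_rfl
    _ = _ := by ring

theorem relCapacity1_le_lintegral {μ : Measure X} {A Ω : Set X} {u : X → ℝ} {g : X → ℝ≥0∞}
    (hu : MemN11 μ u) (hg : IsUpperGradient g u) (hA : ∀ x ∈ A, 1 ≤ u x)
    (hΩ : ∀ x, x ∉ Ω → u x = 0) : relCapacity1 μ A Ω ≤ ∫⁻ x in Ω, g x ∂μ :=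
  iInf_le_of_le u (iInf_le_of_le hu (iInf_le_of_le g (iInf_le_of_le hg
    (iInf_le_of_le hA (iInf_le_of_le hΩ le_rfl)))))

/-- The relative capacity of the union of a test set and a set of zero capacity. -/
theorem relCapacity1_le [OpensMeasurableSpace X] (μ : Measure X) {A P : Set X}
    {g : X → ℝ≥0∞} {w : X → ℝ} (hw : Measurable w) (hg : IsUpperGradient g w)
    (hw0 : ∀ x, 0 ≤ w x) (hA : ∀ x ∈ A, 1 ≤ w x) (hP : capacity1 μ P = 0)
    (hwi : ∫⁻ x, ENNReal.ofReal (w x) ∂μ ≠ ⊤) (hgi : ∫⁻ x, g x ∂μ ≠ ⊤) (c : X) {R : ℝ}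
    (hR : 0 < R) :
    relCapacity1 μ ((A ∪ P) ∩ ball c R) (ball c (2 * R)) ≤
      2 * (∫⁻ x in ball c (2 * R), g x ∂μ) +
      ENNReal.ofReal R⁻¹ * ∫⁻ x in ball c (2 * R), ENNReal.ofReal (w x) ∂μ := by
  have hdiv : ∀ (f : X → ℝ), Measurable f → ∀ S : Set X,
      ∫⁻ x in S, ENNReal.ofReal (f x / R) ∂μ =
      ENNReal.ofReal R⁻¹ * ∫⁻ x in S, ENNReal.ofReal (f x) ∂μ := by
    intro f hf S
    rw [← lintegral_const_mul _ hf.ennreal_ofReal]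
    refine lintegral_congr fun x => ?_
    rw [mul_comm, ← ENNReal.ofReal_mul' (by positivity), div_eq_mul_inv]
  have key : ∀ ε : ℝ≥0, 0 < ε →
      relCapacity1 μ ((A ∪ P) ∩ ball c R) (ball c (2 * R)) ≤
      (2 * (∫⁻ x in ball c (2 * R), g x ∂μ) +
      ENNReal.ofReal R⁻¹ * ∫⁻ x in ball c (2 * R), ENNReal.ofReal (w x) ∂μ) +
      (2 + ENNReal.ofReal R⁻¹) * ε := by
    intro ε hε
    obtain ⟨v, gv, hv, hgv, hv0, -, hvP, hlt⟩ :=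
      exists_capacity_test (μ := μ) (A := P) (c := ε) (by rw [hP]; simpa using hε)
    have hv1 : ∫⁻ x, ENNReal.ofReal (v x) ∂μ ≤ ε := by
      refine le_trans (lintegral_mono fun x => ?_) (le_self_add.trans hlt.le)
      exact ENNReal.ofReal_le_ofReal (le_abs_self _)
    have hv2 : ∫⁻ x, gv x ∂μ ≤ ε := le_add_self.trans hlt.le
    have hv3 : ∫⁻ x, ENNReal.ofReal (v x) ∂μ ≠ ⊤ := ne_top_of_le_ne_top ENNReal.coe_ne_top hv1
    have hgv3 : ∫⁻ x, gv x ∂μ ≠ ⊤ := ne_top_of_le_ne_top ENNReal.coe_ne_top hv2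
    have hsum0 : ∀ x, 0 ≤ (w + v) x := fun x => add_nonneg (hw0 x) (hv0 x)
    have hwv : ∫⁻ x, ENNReal.ofReal ((w + v) x) ∂μ ≤
        (∫⁻ x, ENNReal.ofReal (w x) ∂μ) + ∫⁻ x, ENNReal.ofReal (v x) ∂μ := by
      rw [← lintegral_add_left hw.ennreal_ofReal]
      exact lintegral_mono fun x => ENNReal.ofReal_add_le
    have hUG := (hg.add hgv).mul_cutoff (hw.add hv) hsum0 c hR
    have hmem : MemN11 μ (fun y => (w + v) y * cutoff c R y) := by
      refine ⟨(hw.add hv).mul (measurable_cutoff c R), ?_⟩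
      refine (eN11Norm_le μ hUG).trans_lt (ENNReal.add_lt_top.mpr ⟨?_, ?_⟩)
      · refine lt_of_le_of_lt (lintegral_mono fun x => ?_) (hwv.trans_lt (by finiteness))
        rw [abs_of_nonneg (mul_nonneg (hsum0 x) (cutoff_nonneg _ _ _))]
        exact ENNReal.ofReal_le_ofReal (mul_le_of_le_one_right (hsum0 x) (cutoff_le_one _ _ _))
      · rw [lintegral_indicator measurableSet_ball]
        refine (setLIntegral_le_lintegral _ _).trans_lt ?_
        rw [lintegral_add_left ((hg.add hgv).1.const_mul _), lintegral_const_mul _ (hg.add hgv).1]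
        have h3 : ∫⁻ x, (g + gv) x ∂μ ≠ ⊤ := by
          simp only [Pi.add_apply]
          rw [lintegral_add_left hg.1]; finiteness
        have h4 := hdiv _ (hw.add hv) univ
        rw [Measure.restrict_univ] at h4
        rw [h4]
        have h5 : ∫⁻ x, ENNReal.ofReal ((w + v) x) ∂μ ≠ ⊤ := (hwv.trans_lt (by finiteness)).ne
        finiteness
    refine (relCapacity1_le_lintegral hmem hUG ?_ ?_).trans ?_
    · intro x hx
      rw [cutoff_eq_one hR hx.2, mul_one]
      rcases hx.1 with h | h
      · exact (hA x h).trans (by simp [hv0 x])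
      · exact (hvP x h).trans (by simp [hw0 x])
    · intro x hx
      rw [cutoff_eq_zero hR hx, mul_zero]
    · calc ∫⁻ x in ball c (2 * R), (ball c (3 * R)).indicator
            (fun y => 2 * (g + gv) y + ENNReal.ofReal ((w + v) y / R)) x ∂μ
          ≤ ∫⁻ x in ball c (2 * R), (2 * (g + gv) x + ENNReal.ofReal ((w + v) x / R)) ∂μ :=
            lintegral_mono fun x => indicator_le_self _ _ _
        _ = 2 * ((∫⁻ x in ball c (2 * R), g x ∂μ) + ∫⁻ x in ball c (2 * R), gv x ∂μ) +
            ENNReal.ofReal R⁻¹ * ∫⁻ x in ball c (2 * R), ENNReal.ofReal ((w + v) x) ∂μ := by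
            rw [lintegral_add_left ((hg.add hgv).1.const_mul _),
              lintegral_const_mul _ (hg.add hgv).1, hdiv _ (hw.add hv)]
            simp only [Pi.add_apply]
            rw [lintegral_add_left hg.1]
        _ ≤ 2 * ((∫⁻ x in ball c (2 * R), g x ∂μ) + ε) + ENNReal.ofReal R⁻¹ *
            ((∫⁻ x in ball c (2 * R), ENNReal.ofReal (w x) ∂μ) + ε) := by
            gcongr
            · exact (setLIntegral_le_lintegral _ _).trans hv2
            · calc ∫⁻ x in ball c (2 * R), ENNReal.ofReal ((w + v) x) ∂μ
                  ≤ ∫⁻ x in ball c (2 * R), (ENNReal.ofReal (w x) + ENNReal.ofReal (v x)) ∂μ :=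
                    lintegral_mono fun x => ENNReal.ofReal_add_le
                _ = _ := lintegral_add_left hw.ennreal_ofReal _
                _ ≤ _ := by gcongr; exact (setLIntegral_le_lintegral _ _).trans hv1
        _ = _ := by ring
  refine ge_of_tendsto (f := fun ε : ℝ≥0 => (2 * (∫⁻ x in ball c (2 * R), g x ∂μ) +
      ENNReal.ofReal R⁻¹ * ∫⁻ x in ball c (2 * R), ENNReal.ofReal (w x) ∂μ) +
      (2 + ENNReal.ofReal R⁻¹) * ε) (x := 𝓝[>] 0) ?_
    (eventually_nhdsWithin_of_forall fun ε hε => key ε hε)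
  have h1 : Tendsto (fun ε : ℝ≥0 => (2 + ENNReal.ofReal R⁻¹) * (ε : ℝ≥0∞)) (𝓝[>] 0) (𝓝 0) := by
    have h2 : Tendsto (fun ε : ℝ≥0 => (ε : ℝ≥0∞)) (𝓝[>] 0) (𝓝 0) :=
      (ENNReal.tendsto_coe.mpr tendsto_id).mono_left nhdsWithin_le_nhds
    have h3 := ENNReal.Tendsto.const_mul (a := 2 + ENNReal.ofReal R⁻¹) h2
      (Or.inr (by finiteness))
    simpa using h3
  simpa using tendsto_const_nhds.add h1

section Doubling

variable {μ : Measure X} {Cd : ℝ≥0}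

theorem DoublingWith.measure_ball_ne_zero (hμ : DoublingWith μ Cd) (x : X) {r : ℝ} (hr : 0 < r) :
    μ (ball x r) ≠ 0 := (hμ x r hr).1.ne'

theorem DoublingWith.measure_ball_ne_top (hμ : DoublingWith μ Cd) (x : X) {r : ℝ} (hr : 0 < r) :
    μ (ball x r) ≠ ⊤ := (hμ x r hr).2.2.ne

theorem DoublingWith.measure_ball_pow_le (hμ : DoublingWith μ Cd) (x : X) {r : ℝ} (hr : 0 < r)
    (k : ℕ) : μ (ball x (2 ^ k * r)) ≤ (Cd : ℝ≥0∞) ^ k * μ (ball x r) := by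
  induction k with
  | zero => simp
  | succ k ih =>
    calc μ (ball x (2 ^ (k + 1) * r)) = μ (ball x (2 * (2 ^ k * r))) := by
          rw [pow_succ', mul_assoc]
      _ ≤ Cd * μ (ball x (2 ^ k * r)) := (hμ x _ (by positivity)).2.1
      _ ≤ Cd * ((Cd : ℝ≥0∞) ^ k * μ (ball x r)) := by gcongr
      _ = _ := by rw [pow_succ', mul_assoc]

theorem DoublingWith.exists_measure_ball_mul_le (hμ : DoublingWith μ Cd) (L : ℝ) :
    ∃ K : ℝ≥0, ∀ (x : X) (r : ℝ), 0 < r → μ (ball x (L * r)) ≤ K * μ (ball x r) := by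
  obtain ⟨m, hm⟩ := pow_unbounded_of_one_lt L one_lt_two
  refine ⟨Cd ^ m, fun x r hr => ?_⟩
  rw [ENNReal.coe_pow]
  exact (measure_mono (ball_subset_ball (by gcongr))).trans (hμ.measure_ball_pow_le x hr m)

theorem DoublingWith.isLocallyFiniteMeasure (hμ : DoublingWith μ Cd) :
    IsLocallyFiniteMeasure μ :=
  ⟨fun x => ⟨ball x 1, ball_mem_nhds x one_pos, (hμ x 1 one_pos).2.2⟩⟩

theorem DoublingWith.sigmaFinite (hμ : DoublingWith μ Cd) : SigmaFinite μ := by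
  rcases isEmpty_or_nonempty X with h | ⟨⟨x₀⟩⟩
  · rw [Measure.eq_zero_of_isEmpty μ]
    infer_instance
  · exact ⟨⟨⟨fun n => ball x₀ (n + 1), fun _ => trivial,
      fun n => (hμ x₀ _ (by positivity)).2.2, by
        refine eq_univ_of_forall fun x => mem_iUnion.mpr ?_
        obtain ⟨n, hn⟩ := exists_nat_gt (dist x x₀)
        exact ⟨n, by rw [mem_ball]; linarith⟩⟩⟩⟩

theorem DoublingWith.secondCountableTopology [OpensMeasurableSpace X] (hμ : DoublingWith μ Cd) :
    SecondCountableTopology X := by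
  have := hμ.sigmaFinite
  refine Metric.secondCountable_of_almost_dense_set fun ε hε => ?_
  obtain ⟨S, -, hS, hcov⟩ := Vitali.exists_disjoint_subfamily_covering_enlargement_closedBall
    (univ : Set X) id (fun _ => ε / 5) (ε / 5) (fun _ _ => le_rfl) 5 (by norm_num)
  refine ⟨S, ?_, fun x => ?_⟩
  · have h := Measure.countable_meas_pos_of_disjoint_iUnion (μ := μ)
      (As := fun x : S => closedBall (x : X) (ε / 5)) (fun _ => measurableSet_closedBall)
      (fun x y hxy => hS x.2 y.2 (Subtype.coe_ne_coe.mpr hxy))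
    have h2 : {x : S | 0 < μ (closedBall (x : X) (ε / 5))} = univ :=
      eq_univ_of_forall fun x => lt_of_lt_of_le (hμ x _ (by positivity)).1
        (measure_mono ball_subset_closedBall)
    rw [h2, countable_univ_iff] at h
    exact countable_coe_iff.mp h
  · obtain ⟨b, hb, hsub⟩ := hcov x (mem_univ _)
    refine ⟨b, hb, ?_⟩
    have := hsub (mem_closedBall_self (by positivity))
    rw [mem_closedBall] at this
    simpa [mul_div_cancel₀] using this

theorem DoublingWith.isUnifLocDoublingMeasure (hμ : DoublingWith μ Cd) :
    IsUnifLocDoublingMeasure μ := by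
  refine ⟨⟨Cd ^ 2, eventually_nhdsWithin_of_forall fun ε hε x => ?_⟩⟩
  have hε : 0 < ε := hε
  calc μ (closedBall x (2 * ε)) ≤ μ (ball x (2 ^ 2 * ε)) :=
        measure_mono (closedBall_subset_ball (by linarith))
    _ ≤ (Cd : ℝ≥0∞) ^ 2 * μ (ball x ε) := hμ.measure_ball_pow_le x hε 2
    _ ≤ _ := by
        rw [ENNReal.coe_pow]
        gcongr
        exact ball_subset_closedBall

/-- Vitali covering for capacities. -/
theorem DoublingWith.exists_capacity1_le_tsum [BorelSpace X] (hμ : DoublingWith μ Cd) (A : Set X)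
    (ρ : X → ℝ) (h0 : ∀ x ∈ A, 0 < ρ x) (h1 : ∀ x ∈ A, ρ x ≤ 1) :
    ∃ S ⊆ A, S.Countable ∧ S.PairwiseDisjoint (fun x => closedBall x (ρ x)) ∧
      capacity1 μ A ≤ ∑' x : S, capacity1 μ (A ∩ closedBall x (5 * ρ x)) := by
  have := hμ.secondCountableTopology
  obtain ⟨S, hSA, hS, hcov⟩ := Vitali.exists_disjoint_subfamily_covering_enlargement_closedBall
    A id ρ 1 h1 5 (by norm_num)
  have hc : S.Countable := hS.countable_of_nonempty_interior fun x hx =>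
    ⟨x, ball_subset_interior_closedBall (mem_ball_self (h0 x (hSA hx)))⟩
  have := hc.to_subtype
  refine ⟨S, hSA, hc, hS, le_trans (capacity1_mono μ fun x hx => ?_) (capacity1_iUnion_le μ _)⟩
  obtain ⟨b, hb, hsub⟩ := hcov x hx
  exact mem_iUnion.mpr ⟨⟨b, hb⟩, hx, hsub (mem_closedBall_self (h0 x hx).le)⟩

theorem tsum_measure_closedBall_le [OpensMeasurableSpace X] (ν : Measure X) {S : Set X}
    (hS : S.Countable) {ρ : X → ℝ} (hd : S.PairwiseDisjoint fun x => closedBall x (ρ x)) {U : Set X}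
    (hU : ∀ x ∈ S, closedBall x (ρ x) ⊆ U) : ∑' x : S, ν (closedBall x (ρ x)) ≤ ν U := by
  rw [← measure_biUnion hS hd fun _ _ => measurableSet_closedBall]
  exact measure_mono (iUnion₂_subset hU)

theorem DoublingWith.exists_capacity1_ball_le [BorelSpace X] (hμ : DoublingWith μ Cd) (L : ℝ)
    (hL : 0 < L) : ∃ K : ℝ≥0, ∀ (x : X) (r : ℝ), 0 < r → r ≤ 1 →
      capacity1 μ (ball x (L * r)) ≤ K * (μ (ball x r) / ENNReal.ofReal r) := by
  obtain ⟨K, hK⟩ := hμ.exists_measure_ball_mul_le (3 * L)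
  refine ⟨(1 + (L⁻¹).toNNReal) * K, fun x r hr hr1 => ?_⟩
  have h := capacity1_inter_ball_le μ (A := univ) (g := fun _ => 0) (w := fun _ => 1)
    measurable_const (isUpperGradient_const 1) (fun _ => zero_le_one) (fun _ _ => le_rfl) x
    (R := L * r) (by positivity)
  simp only [univ_inter, lintegral_zero, mul_zero, zero_add, ENNReal.ofReal_one, lintegral_const,
    one_mul, Measure.restrict_apply_univ] at h
  refine h.trans ?_
  have h1 : 1 + ENNReal.ofReal (L * r)⁻¹ ≤ (1 + ENNReal.ofReal L⁻¹) * (ENNReal.ofReal r)⁻¹ := by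
    rw [mul_inv, ENNReal.ofReal_mul (by positivity), add_mul, one_mul, ENNReal.ofReal_inv_of_pos hr]
    gcongr
    rw [ENNReal.one_le_inv]
    simpa using hr1
  calc _ ≤ ((1 + ENNReal.ofReal L⁻¹) * (ENNReal.ofReal r)⁻¹) * (K * μ (ball x r)) := by
        gcongr
        rw [← mul_assoc]
        exact hK x r hr
    _ = _ := by
        rw [ENNReal.coe_mul, ENNReal.coe_add, ENNReal.coe_one, div_eq_mul_inv]
        change _ = (1 + ENNReal.ofReal L⁻¹) * _ * _
        ring

end Doubling
theorem ennreal_eq_zero_of_forall_le_mul {c K : ℝ≥0∞} (hK : K ≠ ⊤)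
    (h : ∀ ε : ℝ≥0∞, 0 < ε → c ≤ K * ε) : c = 0 := by
  have h1 : Tendsto (fun ε : ℝ≥0∞ => K * ε) (𝓝[>] 0) (𝓝 (K * 0)) :=
    ENNReal.Tendsto.const_mul (tendsto_id.mono_left nhdsWithin_le_nhds) (Or.inr hK)
  rw [mul_zero] at h1
  exact nonpos_iff_eq_zero.mp (ge_of_tendsto h1 (eventually_nhdsWithin_of_forall fun ε hε => h ε hε))

section NullCapacity

variable {μ : Measure X} {Cd : ℝ≥0}

theorem DoublingWith.capacity1_le_of_frequently [BorelSpace X] (hμ : DoublingWith μ Cd)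
    {A U : Set X} (ν : Measure X) {M : ℝ≥0∞} (hU : IsOpen U) (hAU : A ⊆ U)
    (h : ∀ x ∈ A, ∃ᶠ r in 𝓝[>] (0 : ℝ),
      capacity1 μ (A ∩ closedBall x (5 * r)) ≤ M * ν (closedBall x r)) :
    capacity1 μ A ≤ M * ν U := by
  have hex : ∀ x, ∃ r : ℝ, x ∈ A → 0 < r ∧ r ≤ 1 ∧ closedBall x r ⊆ U ∧
      capacity1 μ (A ∩ closedBall x (5 * r)) ≤ M * ν (closedBall x r) := by
    intro x
    by_cases hx : x ∈ A
    · obtain ⟨ε, hε, hsub⟩ := nhds_basis_closedBall.mem_iff.mp (hU.mem_nhds (hAU hx))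
      obtain ⟨r, hr, hr0, hr1⟩ :=
        ((h x hx).and_eventually (Ioo_mem_nhdsGT (lt_min one_pos hε))).exists
      exact ⟨r, fun _ => ⟨hr0, hr1.le.trans (min_le_left _ _),
        (closedBall_subset_closedBall (hr1.le.trans (min_le_right _ _))).trans hsub, hr⟩⟩
    · exact ⟨0, fun h => absurd h hx⟩
  choose ρ hρ using hex
  obtain ⟨S, hSA, hS, hd, hcap⟩ := hμ.exists_capacity1_le_tsum A ρ (fun x hx => (hρ x hx).1)
    (fun x hx => (hρ x hx).2.1)
  calc capacity1 μ A ≤ ∑' x : S, capacity1 μ (A ∩ closedBall x (5 * ρ x)) := hcap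
    _ ≤ ∑' x : S, M * ν (closedBall x (ρ x)) :=
        ENNReal.tsum_le_tsum fun x => (hρ x (hSA x.2)).2.2.2
    _ = M * ∑' x : S, ν (closedBall x (ρ x)) := ENNReal.tsum_mul_left
    _ ≤ M * ν U := by
        gcongr
        exact tsum_measure_closedBall_le ν hS hd fun x hx => (hρ x (hSA hx)).2.2.1

theorem DoublingWith.capacity1_eq_zero_of_frequently [BorelSpace X] (hμ : DoublingWith μ Cd)
    {A : Set X} (ν : Measure X) [IsLocallyFiniteMeasure ν] (hν : ν ≪ μ) (hA : μ A = 0)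
    {M : ℝ≥0∞} (hM : M ≠ ⊤)
    (h : ∀ x ∈ A, ∃ᶠ r in 𝓝[>] (0 : ℝ),
      capacity1 μ (A ∩ closedBall x (5 * r)) ≤ M * ν (closedBall x r)) :
    capacity1 μ A = 0 := by
  have := hμ.secondCountableTopology
  refine ennreal_eq_zero_of_forall_le_mul hM fun ε hε => ?_
  obtain ⟨U, hAU, hU, hlt⟩ := A.exists_isOpen_lt_of_lt ε (by rwa [hν hA])
  exact (hμ.capacity1_le_of_frequently ν hU hAU h).trans (by gcongr)

theorem DoublingWith.exists_capacity1_closedBall_le [BorelSpace X] (hμ : DoublingWith μ Cd)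
    (L : ℝ) (hL : 0 < L) : ∃ K : ℝ≥0, ∀ (x : X) (r : ℝ), 0 < r → r ≤ 1 →
      capacity1 μ (closedBall x (L * r)) ≤ K * (μ (ball x r) / ENNReal.ofReal r) := by
  obtain ⟨K, hK⟩ := hμ.exists_capacity1_ball_le (L + 1) (by positivity)
  exact ⟨K, fun x r hr hr1 => (capacity1_mono μ (closedBall_subset_ball (by linarith))).trans
    (hK x r hr hr1)⟩

/-- The points where the mean values of `g` over `ball x r` are not `o(1 / r)`. -/
def gradExceptional (μ : Measure X) (g : X → ℝ≥0∞) : Set X :=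
  {x | ¬ Tendsto (fun r : ℝ => ENNReal.ofReal r * ((∫⁻ y in ball x r, g y ∂μ) / μ (ball x r)))
    (𝓝[>] 0) (𝓝 0)}

theorem DoublingWith.measure_gradExceptional [BorelSpace X] (hμ : DoublingWith μ Cd)
    {g : X → ℝ≥0∞} (hg : Measurable g) (hgi : ∫⁻ x, g x ∂μ ≠ ⊤) :
    μ (gradExceptional μ g) = 0 := by
  have := hμ.secondCountableTopology
  have := hμ.isLocallyFiniteMeasure
  have := hμ.isUnifLocDoublingMeasure
  have h1 := (IsUnifLocDoublingMeasure.vitaliFamily μ 1).ae_tendsto_lintegral_div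
    hg.aemeasurable hgi
  have h2 := ae_lt_top hg hgi
  rw [measure_eq_zero_iff_ae_notMem]
  filter_upwards [h1, h2] with x hx hgx
  rw [gradExceptional, mem_ofPred_eq, not_not]
  have h3 := hx.comp (IsUnifLocDoublingMeasure.tendsto_closedBall_filterAt (μ := μ) (K := 1)
    (x := x) (l := 𝓝[>] (0 : ℝ)) (fun _ => x) (fun r => r) tendsto_id
    (eventually_nhdsWithin_of_forall fun r hr => mem_closedBall_self (by
      have : (0 : ℝ) < r := hr
      positivity)))
  have h4 : ∀ᶠ r in 𝓝[>] (0 : ℝ),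
      (∫⁻ y in closedBall x r, g y ∂μ) / μ (closedBall x r) ≤ g x + 1 :=
    h3.eventually_le_const (ENNReal.lt_add_right hgx.ne one_ne_zero)
  have h5 : Tendsto (fun r : ℝ => ENNReal.ofReal r * (Cd * (g x + 1))) (𝓝[>] 0) (𝓝 0) := by
    have h6 : Tendsto (fun r : ℝ => ENNReal.ofReal r) (𝓝[>] 0) (𝓝 0) := by
      have := (ENNReal.continuous_ofReal.tendsto 0).mono_left (nhdsWithin_le_nhds (s := Ioi 0))
      simpa using this
    have h7 := ENNReal.Tendsto.mul_const (b := Cd * (g x + 1)) h6 (Or.inr (by finiteness))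
    simpa using h7
  refine tendsto_of_tendsto_of_tendsto_of_le_of_le' tendsto_const_nhds h5
    (Eventually.of_forall fun _ => zero_le) ?_
  filter_upwards [h4, self_mem_nhdsWithin] with r hr hr0
  have hr0 : 0 < r := hr0
  have hcb : μ (closedBall x r) ≤ Cd * μ (ball x r) :=
    (measure_mono (closedBall_subset_ball (by linarith))).trans (hμ x r hr0).2.1
  gcongr
  refine ENNReal.div_le_of_le_mul ?_
  calc ∫⁻ y in ball x r, g y ∂μ ≤ ∫⁻ y in closedBall x r, g y ∂μ :=
        lintegral_mono_set ball_subset_closedBall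
    _ ≤ (g x + 1) * μ (closedBall x r) := by
        refine (ENNReal.div_le_iff_le_mul (Or.inl ?_) (Or.inl ?_)).mp hr
        · exact (lt_of_lt_of_le (hμ x r hr0).1 (measure_mono ball_subset_closedBall)).ne'
        · exact (hcb.trans_lt (ENNReal.mul_lt_top ENNReal.coe_lt_top (hμ x r hr0).2.2)).ne
    _ ≤ (g x + 1) * (Cd * μ (ball x r)) := by gcongr
    _ = _ := by ring

theorem DoublingWith.capacity1_gradExceptional [BorelSpace X] (hμ : DoublingWith μ Cd)
    {g : X → ℝ≥0∞} (hg : Measurable g) (hgi : ∫⁻ x, g x ∂μ ≠ ⊤) :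
    capacity1 μ (gradExceptional μ g) = 0 := by
  set φ : X → ℝ → ℝ≥0∞ := fun x r =>
    ENNReal.ofReal r * ((∫⁻ y in ball x r, g y ∂μ) / μ (ball x r))
  set A : ℕ → Set X := fun n => {x | ∃ᶠ r in 𝓝[>] (0 : ℝ), (n : ℝ≥0∞)⁻¹ < φ x r}
  have hsub : ∀ n, A n ⊆ gradExceptional μ g := by
    intro n x hx ht
    refine hx ?_
    filter_upwards [ENNReal.tendsto_nhds_zero.mp ht (n : ℝ≥0∞)⁻¹
      (ENNReal.inv_pos.mpr (ENNReal.natCast_ne_top n))] with r hr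
    exact not_lt.mpr hr
  have hcov : gradExceptional μ g ⊆ ⋃ n, A n := by
    intro x hx
    have hx : ¬ Tendsto (φ x) (𝓝[>] 0) (𝓝 0) := hx
    rw [ENNReal.tendsto_nhds_zero] at hx
    push Not at hx
    obtain ⟨ε, hε, hx⟩ := hx
    obtain ⟨n, hn⟩ := ENNReal.exists_inv_nat_lt hε.ne'
    exact mem_iUnion.mpr ⟨n, hx.mono fun r hr => hn.trans hr⟩
  refine nonpos_iff_eq_zero.mp ((capacity1_mono μ hcov).trans (le_of_eq ?_))
  refine capacity1_iUnion_eq_zero fun n => ?_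
  obtain ⟨K, hK⟩ := hμ.exists_capacity1_closedBall_le 5 (by norm_num)
  have hfin : IsFiniteMeasure (μ.withDensity g) := isFiniteMeasure_withDensity hgi
  refine hμ.capacity1_eq_zero_of_frequently (μ.withDensity g) (withDensity_absolutelyContinuous _ _)
    (measure_mono_null (hsub n) (hμ.measure_gradExceptional hg hgi)) (M := K * n) (by finiteness)
    fun x hx => (hx.and_eventually (Ioo_mem_nhdsGT one_pos)).mono ?_
  rintro r ⟨hr, hr0, hr1⟩
  have hB := hμ.measure_ball_ne_zero x hr0
  have hB' := hμ.measure_ball_ne_top x hr0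
  have key : μ (ball x r) / ENNReal.ofReal r ≤ n * ∫⁻ y in ball x r, g y ∂μ := by
    have hn : (n : ℝ≥0∞) ≠ 0 := by
      rintro h
      simp [h] at hr
    refine ENNReal.div_le_of_le_mul ?_
    calc μ (ball x r) = μ (ball x r) * n * (n : ℝ≥0∞)⁻¹ := by
          rw [mul_assoc, ENNReal.mul_inv_cancel hn (ENNReal.natCast_ne_top n), mul_one]
      _ ≤ μ (ball x r) * n *
          (ENNReal.ofReal r * ((∫⁻ y in ball x r, g y ∂μ) / μ (ball x r))) := by
          gcongr
      _ = n * ENNReal.ofReal r * ((∫⁻ y in ball x r, g y ∂μ) / μ (ball x r) * μ (ball x r)) := by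
          ring
      _ = n * ENNReal.ofReal r * ∫⁻ y in ball x r, g y ∂μ := by
          rw [ENNReal.div_mul_cancel hB hB']
      _ = _ := by ring
  calc capacity1 μ (A n ∩ closedBall x (5 * r)) ≤ capacity1 μ (closedBall x (5 * r)) :=
        capacity1_mono μ inter_subset_right
    _ ≤ K * (μ (ball x r) / ENNReal.ofReal r) := hK x r hr0 hr1.le
    _ ≤ K * (n * ∫⁻ y in ball x r, g y ∂μ) := by gcongr
    _ ≤ K * (n * ∫⁻ y in closedBall x r, g y ∂μ) := by
        gcongr
        exact ball_subset_closedBall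
    _ = _ := by rw [withDensity_apply _ measurableSet_closedBall, mul_assoc]

end NullCapacity
/-- The piecewise linear function equal to `0` at `s`, to `1` at `t` and constant off the segment
between them. -/
def ramp (s t z : ℝ) : ℝ := max 0 (min 1 ((z - s) / (t - s)))

theorem ramp_nonneg (s t z : ℝ) : 0 ≤ ramp s t z := le_max_left _ _

theorem ramp_le_one (s t z : ℝ) : ramp s t z ≤ 1 := max_le zero_le_one (min_le_left _ _)

theorem measurable_ramp (s t : ℝ) : Measurable (ramp s t) := by
  unfold ramp
  fun_prop

theorem abs_ramp_sub_le (s t y z : ℝ) : |ramp s t y - ramp s t z| ≤ |t - s|⁻¹ * |y - z| := by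
  unfold ramp
  refine (abs_max_sub_max_le_max _ _ _ _).trans ?_
  rw [sub_self, abs_zero, max_eq_right (abs_nonneg _)]
  refine (abs_min_sub_min_le_max _ _ _ _).trans ?_
  rw [sub_self, abs_zero, max_eq_right (abs_nonneg _), div_sub_div_same, sub_sub_sub_cancel_right,
    abs_div, div_eq_inv_mul]

theorem ramp_eq_zero {s t z : ℝ} (h : s < t) (hz : z ≤ s) : ramp s t z = 0 := by
  have : (z - s) / (t - s) ≤ 0 := div_nonpos_of_nonpos_of_nonneg (by linarith) (by linarith)
  rw [ramp, max_eq_left]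
  exact (min_le_right _ _).trans this

theorem ramp_eq_one {s t z : ℝ} (h : s < t) (hz : t ≤ z) : ramp s t z = 1 := by
  have : 1 ≤ (z - s) / (t - s) := (one_le_div (by linarith)).mpr (by linarith)
  rw [ramp, min_eq_left this, max_eq_right zero_le_one]

theorem ramp_eq_zero_of_gt {s t z : ℝ} (h : t < s) (hz : s ≤ z) : ramp s t z = 0 := by
  have : (z - s) / (t - s) ≤ 0 := div_nonpos_of_nonneg_of_nonpos (by linarith) (by linarith)
  rw [ramp, max_eq_left]
  exact (min_le_right _ _).trans this

theorem ramp_eq_one_of_gt {s t z : ℝ} (h : t < s) (hz : z ≤ t) : ramp s t z = 1 := by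
  have : 1 ≤ (z - s) / (t - s) := (one_le_div_of_neg (by linarith)).mpr (by linarith)
  rw [ramp, min_eq_left this, max_eq_right zero_le_one]

theorem IsUpperGradient.ramp_comp {g : X → ℝ≥0∞} {u : X → ℝ} (hg : IsUpperGradient g u)
    (s t : ℝ) :
    IsUpperGradient (fun x => ENNReal.ofReal |t - s|⁻¹ * g x) (fun x => ramp s t (u x)) :=
  hg.comp_lipschitz (by positivity) (abs_ramp_sub_le s t)

theorem IsUpperGradient.ramp_comp_localized [OpensMeasurableSpace X] {g : X → ℝ≥0∞} {u : X → ℝ}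
    (hg : IsUpperGradient g u) (hu : Measurable u) {s t : ℝ} (hst : s < t) {δ : ℝ≥0∞}
    (hδ : δ ≠ 0) :
    IsUpperGradient (fun x => ENNReal.ofReal (t - s)⁻¹ *
      ({y | s < u y ∧ u y < t}.indicator g x + δ * g x)) (fun x => ramp s t (u x)) := by
  have hL : ∀ y z : ℝ, |(y - s) / (t - s) - (z - s) / (t - s)| ≤ (t - s)⁻¹ * |y - z| := by
    intro y z
    rw [div_sub_div_same, sub_sub_sub_cancel_right, abs_div, div_eq_inv_mul,
      abs_of_pos (sub_pos.mpr hst)]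
  have h := (hg.truncate hu hst.le hδ).comp_lipschitz (inv_nonneg.mpr (sub_pos.mpr hst).le) hL
  convert h using 2 with x
  rcases le_total (u x) s with h1 | h1
  · rw [ramp_eq_zero hst h1, min_eq_left (h1.trans hst.le), max_eq_left h1]
    simp
  rcases le_total t (u x) with h2 | h2
  · rw [ramp_eq_one hst h2, min_eq_right h2, max_eq_right hst.le, div_self (sub_pos.mpr hst).ne']
  · rw [min_eq_left h2, max_eq_right h1, ramp, min_eq_right, max_eq_right]
    · exact div_nonneg (by linarith) (by linarith)
    · exact (div_le_one (by linarith)).mpr (by linarith)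

section Poincare

variable {μ : Measure X} {Cd : ℝ≥0} {CP lam : ℝ}

/-- The Poincaré inequality for a function that vanishes on a large part of the ball. -/
theorem PoincareIneq.mul_setLIntegral_le [BorelSpace X] (hP : PoincareIneq μ CP lam)
    (hlam : 1 ≤ lam) (hμ : DoublingWith μ Cd) {w : X → ℝ} {g : X → ℝ≥0∞} (hw : Measurable w)
    (hg : IsUpperGradient g w) (hw0 : ∀ y, 0 ≤ w y) (hw1 : ∀ y, w y ≤ 1) (x : X) {r : ℝ}
    (hr : 0 < r) {θ : ℝ≥0∞} (hθ : θ * μ (ball x r) ≤ μ (ball x r ∩ {y | w y = 0})) :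
    θ * ∫⁻ y in ball x r, ENNReal.ofReal (w y) ∂μ ≤
      ENNReal.ofReal (CP * r) * ∫⁻ y in ball x (lam * r), g y ∂μ := by
  have := hμ.isLocallyFiniteMeasure
  have hB := hμ.measure_ball_ne_zero x hr
  have hB' := hμ.measure_ball_ne_top x hr
  have hbdd : ∀ y, ‖w y‖ ≤ 1 := fun y => by
    rw [Real.norm_of_nonneg (hw0 y)]
    exact hw1 y
  have hloc : LocallyIntegrable w μ :=
    (locallyIntegrable_const (1 : ℝ)).mono hw.aestronglyMeasurable
      (Eventually.of_forall fun y => by simpa using hbdd y)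
  have hint : IntegrableOn w (ball x r) μ :=
    Measure.integrableOn_of_bounded hB' hw.aestronglyMeasurable (Eventually.of_forall hbdd)
  set m : ℝ := ⨍ z in ball x r, w z ∂μ with hm
  have hm1 : ENNReal.ofReal m * μ (ball x r) = ∫⁻ y in ball x r, ENNReal.ofReal (w y) ∂μ := by
    rw [← ofReal_integral_eq_lintegral_ofReal hint (Eventually.of_forall hw0), hm,
      setAverage_eq, smul_eq_mul, measureReal_def, ENNReal.ofReal_mul (by positivity),
      ENNReal.ofReal_inv_of_pos (ENNReal.toReal_pos hB hB'), ENNReal.ofReal_toReal hB',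
      mul_right_comm, ENNReal.inv_mul_cancel hB hB', one_mul]
  have hm0 : 0 ≤ m := by
    rw [hm, setAverage_eq]
    exact smul_nonneg (by positivity) (integral_nonneg hw0)
  have hZ : MeasurableSet {y | w y = 0} := hw (measurableSet_singleton 0)
  have h1 : ENNReal.ofReal m * μ (ball x r ∩ {y | w y = 0}) ≤
      ∫⁻ y in ball x r, ENNReal.ofReal |w y - m| ∂μ := by
    rw [← setLIntegral_const]
    refine (setLIntegral_mono' (measurableSet_ball.inter hZ) fun y hy => ?_).trans
      (lintegral_mono_set inter_subset_left)
    have hy0 : w y = 0 := hy.2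
    rw [hy0, zero_sub, abs_neg, abs_of_nonneg hm0]
  have h2 : ∫⁻ y in ball x r, ENNReal.ofReal |w y - m| ∂μ ≤
      ENNReal.ofReal (CP * r) * ∫⁻ y in ball x (lam * r), g y ∂μ := by
    have h3 := hP x r hr w g hloc hg
    rw [ENNReal.div_le_iff hB hB'] at h3
    refine h3.trans ?_
    rw [mul_assoc]
    gcongr
    rw [mul_comm, ← mul_div_assoc]
    refine ENNReal.div_le_of_le_mul ?_
    rw [mul_comm]
    gcongr
    nlinarith
  calc θ * ∫⁻ y in ball x r, ENNReal.ofReal (w y) ∂μ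
      = ENNReal.ofReal m * (θ * μ (ball x r)) := by rw [← hm1]; ring
    _ ≤ ENNReal.ofReal m * μ (ball x r ∩ {y | w y = 0}) := by gcongr
    _ ≤ _ := h1.trans h2

theorem PoincareIneq.measure_superlevel_le [BorelSpace X] (hP : PoincareIneq μ CP lam)
    (hlam : 1 ≤ lam) (hμ : DoublingWith μ Cd) {u : X → ℝ} {g : X → ℝ≥0∞} (hu : Measurable u)
    (hg : IsUpperGradient g u) (hgi : ∫⁻ y, g y ∂μ ≠ ⊤) (x : X) {r : ℝ}
    (hr : 0 < r) {s t : ℝ} (hst : s < t) {θ : ℝ≥0∞}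
    (hθ : θ * μ (ball x r) ≤ μ (ball x r ∩ {y | u y ≤ s})) :
    θ * μ (ball x r ∩ {y | t ≤ u y}) ≤ ENNReal.ofReal (CP * r) *
      (ENNReal.ofReal (t - s)⁻¹ * ∫⁻ y in ball x (lam * r) ∩ {y | s < u y ∧ u y < t}, g y ∂μ) := by
  have hS : MeasurableSet {y | s < u y ∧ u y < t} :=
    (measurableSet_lt measurable_const hu).inter (measurableSet_lt hu measurable_const)
  have hT : MeasurableSet {y | t ≤ u y} := measurableSet_le measurable_const hu
  set I := ∫⁻ y in ball x (lam * r) ∩ {y | s < u y ∧ u y < t}, g y ∂μ with hI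
  set J := ∫⁻ y in ball x (lam * r), g y ∂μ with hJ
  have hJtop : J ≠ ⊤ := ne_top_of_le_ne_top hgi (setLIntegral_le_lintegral _ _)
  have key : ∀ δ : ℝ≥0∞, 0 < δ → θ * μ (ball x r ∩ {y | t ≤ u y}) ≤
      ENNReal.ofReal (CP * r) * (ENNReal.ofReal (t - s)⁻¹ * (I + J * δ)) := by
    intro δ hδ
    have h := hP.mul_setLIntegral_le hlam hμ ((measurable_ramp s t).comp hu)
      (hg.ramp_comp_localized hu hst hδ.ne') (fun _ => ramp_nonneg _ _ _)
      (fun _ => ramp_le_one _ _ _) x hr (θ := θ)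
      (hθ.trans (measure_mono (inter_subset_inter_right _ fun y hy => ramp_eq_zero hst hy)))
    rw [lintegral_const_mul (f := fun y => {y | s < u y ∧ u y < t}.indicator g y + δ * g y) _
      ((hg.1.indicator hS).add (hg.1.const_mul _)), lintegral_add_left (hg.1.indicator hS),
      lintegral_const_mul _ hg.1,
      setLIntegral_indicator hS, inter_comm, ← hI, ← hJ, mul_comm δ] at h
    refine le_trans ?_ h
    gcongr
    calc μ (ball x r ∩ {y | t ≤ u y}) = ∫⁻ y in ball x r ∩ {y | t ≤ u y}, 1 ∂μ := by simp
      _ ≤ ∫⁻ y in ball x r ∩ {y | t ≤ u y}, ENNReal.ofReal (ramp s t (u y)) ∂μ := by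
          refine setLIntegral_mono' (measurableSet_ball.inter hT) fun y hy => ?_
          rw [ramp_eq_one hst hy.2, ENNReal.ofReal_one]
      _ ≤ _ := lintegral_mono_set inter_subset_left
  refine ge_of_tendsto (f := fun δ => ENNReal.ofReal (CP * r) *
    (ENNReal.ofReal (t - s)⁻¹ * (I + J * δ))) (x := 𝓝[>] 0) ?_
    (eventually_nhdsWithin_of_forall key)
  have h1 : Tendsto (fun δ : ℝ≥0∞ => J * δ) (𝓝[>] 0) (𝓝 (J * 0)) :=
    ENNReal.Tendsto.const_mul (tendsto_id.mono_left nhdsWithin_le_nhds) (Or.inr hJtop)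
  have h2 := ENNReal.Tendsto.const_mul (a := ENNReal.ofReal (CP * r))
    (ENNReal.Tendsto.const_mul (a := ENNReal.ofReal (t - s)⁻¹)
    (tendsto_const_nhds.add h1 : Tendsto (fun δ : ℝ≥0∞ => I + J * δ) _ _)
    (Or.inr ENNReal.ofReal_ne_top)) (Or.inr ENNReal.ofReal_ne_top)
  simpa using h2

end Poincare
section DensityPoints

variable {μ : Measure X} {Cd : ℝ≥0}

theorem DoublingWith.ae_eventually_measure_inter_le [BorelSpace X] (hμ : DoublingWith μ Cd)
    {E : Set X} (hE : MeasurableSet E) {η : ℝ≥0∞} (hη : η ≠ 0) :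
    ∀ᵐ x ∂μ, x ∉ E → ∀ᶠ r in 𝓝[>] (0 : ℝ), μ (ball x r ∩ E) ≤ η * μ (ball x r) := by
  have := hμ.secondCountableTopology
  have := hμ.isLocallyFiniteMeasure
  have := hμ.isUnifLocDoublingMeasure
  have h1 := (IsUnifLocDoublingMeasure.vitaliFamily μ 1).ae_tendsto_measure_inter_div_of_measurableSet
    hE
  filter_upwards [h1] with x hx hxE
  rw [indicator_of_notMem hxE] at hx
  have h3 := hx.comp (IsUnifLocDoublingMeasure.tendsto_closedBall_filterAt (μ := μ) (K := 1)
    (x := x) (l := 𝓝[>] (0 : ℝ)) (fun _ => x) (fun r => r) tendsto_id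
    (eventually_nhdsWithin_of_forall fun r hr => mem_closedBall_self (by
      have : (0 : ℝ) < r := hr
      positivity)))
  have h4 : ∀ᶠ r in 𝓝[>] (0 : ℝ), μ (E ∩ closedBall x r) / μ (closedBall x r) ≤ η / Cd :=
    h3.eventually_le_const (ENNReal.div_pos hη ENNReal.coe_ne_top)
  filter_upwards [h4, self_mem_nhdsWithin] with r hr hr0
  have hr0 : 0 < r := hr0
  have hcb : μ (closedBall x r) ≤ Cd * μ (ball x r) :=
    (measure_mono (closedBall_subset_ball (by linarith))).trans (hμ x r hr0).2.1
  calc μ (ball x r ∩ E) ≤ μ (E ∩ closedBall x r) :=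
        measure_mono fun y hy => ⟨hy.2, ball_subset_closedBall hy.1⟩
    _ ≤ η / Cd * μ (closedBall x r) := by
        refine (ENNReal.div_le_iff_le_mul (Or.inl ?_) (Or.inl ?_)).mp hr
        · exact (lt_of_lt_of_le (hμ x r hr0).1 (measure_mono ball_subset_closedBall)).ne'
        · exact (hcb.trans_lt (ENNReal.mul_lt_top ENNReal.coe_lt_top (hμ x r hr0).2.2)).ne
    _ ≤ η / Cd * (Cd * μ (ball x r)) := by gcongr
    _ = η / Cd * Cd * μ (ball x r) := by rw [mul_assoc]
    _ ≤ _ := by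
        gcongr
        exact ENNReal.mul_le_of_le_div le_rfl

theorem DoublingWith.exists_frequently_measure_ball_mul_le (hμ : DoublingWith μ Cd) (L : ℝ) :
    ∃ K : ℝ≥0, ∀ ν : Measure X, μ ≤ ν → IsLocallyFiniteMeasure ν → ∀ x,
      ∃ᶠ r in 𝓝[>] (0 : ℝ), ν (ball x (L * r)) ≤ K * ν (ball x r) := by
  obtain ⟨m, hm⟩ := pow_unbounded_of_one_lt L one_lt_two
  refine ⟨2 * Cd ^ m, fun ν hν hfin x hcon => ?_⟩
  push Not at hcon
  obtain ⟨U, hxU, hU⟩ := ν.finiteAt_nhds x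
  obtain ⟨ε₁, hε₁, hball⟩ := Metric.mem_nhds_iff.mp hxU
  obtain ⟨ε₂, hε₂, hlt⟩ := mem_nhdsGT_iff_exists_Ioo_subset.mp hcon
  have hε₂ : 0 < ε₂ := hε₂
  have hgrow : ∀ k : ℕ, ∀ r, 0 < r → r < ε₂ → 2 ^ k * μ (ball x r) ≤ ν (ball x r) := by
    intro k
    induction k with
    | zero => intro r _ _; simpa using hν (ball x r)
    | succ k ih =>
      intro r hr hrε
      have hr' : 0 < r / 2 ^ m := by positivity
      have hrε' : r / 2 ^ m < ε₂ := (div_le_self hr.le (one_le_pow₀ one_le_two)).trans_lt hrε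
      have heq : 2 ^ m * (r / 2 ^ m) = r := mul_div_cancel₀ r (by positivity)
      calc 2 ^ (k + 1) * μ (ball x r) = 2 ^ (k + 1) * μ (ball x (2 ^ m * (r / 2 ^ m))) := by
            rw [heq]
        _ ≤ 2 ^ (k + 1) * ((Cd : ℝ≥0∞) ^ m * μ (ball x (r / 2 ^ m))) := by
            gcongr
            exact hμ.measure_ball_pow_le x hr' m
        _ = ((2 * Cd ^ m : ℝ≥0) : ℝ≥0∞) * (2 ^ k * μ (ball x (r / 2 ^ m))) := by
            push_cast
            ring
        _ ≤ ((2 * Cd ^ m : ℝ≥0) : ℝ≥0∞) * ν (ball x (r / 2 ^ m)) := by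
            gcongr
            exact ih _ hr' hrε'
        _ ≤ ν (ball x (L * (r / 2 ^ m))) := (hlt ⟨hr', hrε'⟩).le
        _ ≤ ν (ball x r) := by
            refine measure_mono (ball_subset_ball ?_)
            calc L * (r / 2 ^ m) ≤ 2 ^ m * (r / 2 ^ m) := by gcongr
              _ = r := heq
  obtain ⟨r, hr0, hr⟩ := exists_between (lt_min hε₁ hε₂)
  have hνr : ν (ball x r) ≠ ⊤ :=
    ((measure_mono ((ball_subset_ball (hr.le.trans (min_le_left _ _))).trans hball)).trans_lt hU).ne
  obtain ⟨n, hn⟩ := ENNReal.exists_nat_mul_gt (hμ.measure_ball_ne_zero x hr0) hνr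
  refine absurd (hgrow n r hr0 (hr.trans_le (min_le_right _ _))) (not_le.mpr (hn.trans_le ?_))
  gcongr
  exact_mod_cast Nat.lt_two_pow_self.le

end DensityPoints

section LowValues

variable {μ : Measure X} {Cd : ℝ≥0} {CP lam : ℝ}

/-- The points where `u ≤ a` although `{u < b}` has density at most `1 / 2` at small scales. -/
def lowExceptional (μ : Measure X) (u : X → ℝ) (a b : ℝ) : Set X :=
  {x | u x ≤ a ∧ ∀ᶠ r in 𝓝[>] (0 : ℝ), 2 * μ (ball x r ∩ {y | u y < b}) ≤ μ (ball x r)}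

theorem inv_two_mul_le_of_two_mul_inter_le {X : Type*} [MeasurableSpace X]
    {μ : Measure X} {B E : Set X} (hE : MeasurableSet E) (hB : μ B ≠ ⊤)
    (h : 2 * μ (B ∩ E) ≤ μ B) : 2⁻¹ * μ B ≤ μ (B \ E) := by
  have h1 : μ (B ∩ E) ≤ 2⁻¹ * μ B := by
    rw [← ENNReal.div_eq_inv_mul, ENNReal.le_div_iff_mul_le (by simp) (by simp), mul_comm]
    exact h
  have h2 : 2⁻¹ * μ B + 2⁻¹ * μ B ≤ 2⁻¹ * μ B + μ (B \ E) := by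
    rw [← add_mul, ENNReal.inv_two_add_inv_two, one_mul]
    exact (measure_inter_add_sdiff B hE).ge.trans (by gcongr)
  exact (ENNReal.add_le_add_iff_left (by finiteness)).mp h2

theorem DoublingWith.measure_lowExceptional [BorelSpace X] (hμ : DoublingWith μ Cd)
    {u : X → ℝ} (hu : Measurable u) {a b : ℝ} (hab : a < b) :
    μ (lowExceptional μ u a b) = 0 := by
  rw [measure_eq_zero_iff_ae_notMem]
  filter_upwards [hμ.ae_eventually_measure_inter_le
    (measurableSet_le measurable_const hu : MeasurableSet {y | b ≤ u y}) (η := 4⁻¹) (by simp)]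
    with x hx hmem
  have hxb : x ∉ {y | b ≤ u y} := not_le.mpr (hmem.1.trans_lt hab)
  obtain ⟨r, ⟨h1, h2⟩, hr0⟩ := (((hx hxb).and hmem.2).and self_mem_nhdsWithin).exists
  have hr0 : 0 < r := hr0
  have hB := hμ.measure_ball_ne_zero x hr0
  have hB' := hμ.measure_ball_ne_top x hr0
  have h3 := (inv_two_mul_le_of_two_mul_inter_le (measurableSet_lt hu measurable_const) hB' h2).trans
    ((measure_mono (t := ball x r ∩ {y | b ≤ u y}) fun y hy =>
      ⟨hy.1, (not_lt.mp hy.2 : b ≤ u y)⟩).trans h1)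
  rw [ENNReal.mul_le_mul_iff_left hB hB', ENNReal.inv_le_inv] at h3
  norm_num at h3

theorem PoincareIneq.capacity1_lowExceptional [BorelSpace X] (hP : PoincareIneq μ CP lam)
    (hCP : 0 ≤ CP) (hlam : 1 ≤ lam) (hμ : DoublingWith μ Cd) {u : X → ℝ} {g : X → ℝ≥0∞}
    (hu : Measurable u) (hg : IsUpperGradient g u) (hgi : ∫⁻ y, g y ∂μ ≠ ⊤) {a b : ℝ}
    (hab : a < b) : capacity1 μ (lowExceptional μ u a b) = 0 := by
  have := hμ.isLocallyFiniteMeasure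
  have hfin : IsFiniteMeasure (μ.withDensity g) := isFiniteMeasure_withDensity hgi
  obtain ⟨K, hK⟩ := hμ.exists_frequently_measure_ball_mul_le (lam * 18)
  set ν := μ + μ.withDensity g
  have hν : IsLocallyFiniteMeasure ν := by
    refine ⟨fun x => ?_⟩
    obtain ⟨s, hs, hsμ⟩ := μ.finiteAt_nhds x
    exact ⟨s, hs, by
      rw [Measure.add_apply]
      exact ENNReal.add_lt_top.mpr ⟨hsμ, measure_lt_top _ _⟩⟩
  have hac : ν ≪ μ := Measure.AbsolutelyContinuous.rfl.add_left
    (withDensity_absolutelyContinuous _ _)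
  set κ : ℝ≥0∞ := ENNReal.ofReal |a - b|⁻¹ with hκ
  refine hμ.capacity1_eq_zero_of_frequently ν hac (hμ.measure_lowExceptional hu hab)
    (M := (2 + ENNReal.ofReal (42 * CP)) * κ * K) (by finiteness) fun x hx => ?_
  have hten : Tendsto (fun r : ℝ => 18 * r) (𝓝[>] 0) (𝓝[>] 0) := by
    refine tendsto_nhdsWithin_iff.mpr ⟨?_, eventually_nhdsWithin_of_forall fun r hr => ?_⟩
    · have : Tendsto (fun r : ℝ => 18 * r) (𝓝 0) (𝓝 (18 * 0)) := tendsto_id.const_mul 18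
      rw [mul_zero] at this
      exact this.mono_left nhdsWithin_le_nhds
    · have : (0 : ℝ) < r := hr
      exact mem_Ioi.mpr (by positivity)
  refine ((hK ν (Measure.le_add_right le_rfl) hν x).and_eventually
    ((hten.eventually hx.2).and (Ioo_mem_nhdsGT one_pos))).mono ?_
  rintro r ⟨hνr, hdens, hr0, hr1⟩
  have h18 : 0 < 18 * r := by positivity
  set G := ∫⁻ y in ball x (lam * (18 * r)), g y ∂μ with hG
  have hw := hP.mul_setLIntegral_le hlam hμ ((measurable_ramp b a).comp hu) (hg.ramp_comp b a)
    (fun _ => ramp_nonneg _ _ _) (fun _ => ramp_le_one _ _ _) x h18 (θ := 2⁻¹)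
    ((inv_two_mul_le_of_two_mul_inter_le (measurableSet_lt hu measurable_const)
      (hμ.measure_ball_ne_top x h18) hdens).trans
      (measure_mono fun y hy => ⟨hy.1, ramp_eq_zero_of_gt hab (not_lt.mp hy.2)⟩))
  have hcap := capacity1_inter_ball_le μ (A := lowExceptional μ u a b)
    ((measurable_ramp b a).comp hu) (hg.ramp_comp b a) (fun _ => ramp_nonneg _ _ _)
    (fun y hy => (ramp_eq_one_of_gt hab hy.1).ge) x (R := 6 * r) (by positivity)
  rw [show 3 * (6 * r) = 18 * r by ring] at hcap
  rw [lintegral_const_mul _ hg.1] at hw hcap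
  set W := ∫⁻ y in ball x (18 * r), ENNReal.ofReal ((ramp b a ∘ u) y) ∂μ
  have hW : W ≤ 2 * (ENNReal.ofReal (CP * (18 * r)) * (κ * G)) := by
    calc W = 2 * (2⁻¹ * W) := by
          rw [← mul_assoc, ENNReal.mul_inv_cancel (by simp) (by simp), one_mul]
      _ ≤ _ := by gcongr
  have hcoef : (1 + ENNReal.ofReal (6 * r)⁻¹) * (2 * ENNReal.ofReal (CP * (18 * r))) ≤
      ENNReal.ofReal (42 * CP) := by
    rw [← ENNReal.ofReal_one, ← ENNReal.ofReal_add zero_le_one (by positivity),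
      ← ENNReal.ofReal_ofNat 2, ← ENNReal.ofReal_mul zero_le_two,
      ← ENNReal.ofReal_mul (by positivity)]
    refine ENNReal.ofReal_le_ofReal ?_
    have : (1 + (6 * r)⁻¹) * (2 * (CP * (18 * r))) = 36 * CP * r + 6 * CP := by
      field_simp
      ring
    rw [this]
    nlinarith
  have hGG : ∫⁻ y in ball x (18 * r), g y ∂μ ≤ G :=
    lintegral_mono_set (ball_subset_ball (by nlinarith))
  have hGν : G ≤ ν (ball x (lam * 18 * r)) := by
    rw [hG, ← withDensity_apply _ measurableSet_ball, ← mul_assoc]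
    exact Measure.le_add_left le_rfl _
  calc capacity1 μ (lowExceptional μ u a b ∩ closedBall x (5 * r))
      ≤ capacity1 μ (lowExceptional μ u a b ∩ ball x (6 * r)) :=
        capacity1_mono μ (inter_subset_inter_right _ (closedBall_subset_ball (by linarith)))
    _ ≤ 2 * (κ * ∫⁻ y in ball x (18 * r), g y ∂μ) + (1 + ENNReal.ofReal (6 * r)⁻¹) * W := hcap
    _ ≤ 2 * (κ * G) + (1 + ENNReal.ofReal (6 * r)⁻¹) *
        (2 * (ENNReal.ofReal (CP * (18 * r)) * (κ * G))) := by
        gcongr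
    _ = 2 * (κ * G) + (1 + ENNReal.ofReal (6 * r)⁻¹) *
        (2 * ENNReal.ofReal (CP * (18 * r))) * (κ * G) := by ring
    _ ≤ 2 * (κ * G) + ENNReal.ofReal (42 * CP) * (κ * G) := by gcongr
    _ = (2 + ENNReal.ofReal (42 * CP)) * κ * G := by ring
    _ ≤ (2 + ENNReal.ofReal (42 * CP)) * κ * (K * ν (ball x r)) := by
        gcongr
        exact hGν.trans hνr
    _ ≤ (2 + ENNReal.ofReal (42 * CP)) * κ * (K * ν (closedBall x r)) := by
        gcongr
        exact ball_subset_closedBall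
    _ = _ := by ring

end LowValues
section Oscillation

/-- A monotone function has a level from which it grows at most as fast as its mean growth. -/
theorem exists_growth_le {m : ℝ → ℝ} (hm : Monotone m) {a b K : ℝ} (hab : a < b)
    (h : m b - m a < K * (b - a)) :
    ∃ σ, a ≤ σ ∧ σ < b ∧ ∀ s, σ < s → s ≤ b → m s - m σ ≤ K * (s - σ) := by
  have hK : 0 < K := by
    by_contra hK
    nlinarith [hm hab.le]
  set T : Set ℝ := {t | t ∈ Icc a b ∧ m a - K * a ≤ m t - K * t} with hT
  have haT : a ∈ T := ⟨left_mem_Icc.mpr hab.le, le_rfl⟩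
  have hbdd : BddAbove T := ⟨b, fun t ht => ht.1.2⟩
  have hσb : sSup T ≤ b := csSup_le ⟨a, haT⟩ fun t ht => ht.1.2
  have hσ : sSup T ≤ (m (sSup T) - (m a - K * a)) / K := by
    refine csSup_le ⟨a, haT⟩ fun t ht => ?_
    rw [le_div_iff₀ hK]
    linarith [ht.2, hm (le_csSup hbdd ht)]
  rw [le_div_iff₀ hK] at hσ
  have hlt : sSup T < b := by
    refine lt_of_le_of_ne hσb fun heq => ?_
    rw [heq] at hσ
    linarith
  refine ⟨sSup T, le_csSup hbdd haT, hlt, fun s hs hsb => ?_⟩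
  have hsT : s ∉ T := fun hmem => absurd (le_csSup hbdd hmem) (not_le.mpr hs)
  have : ¬ m a - K * a ≤ m s - K * s := fun h' =>
    hsT ⟨⟨(le_csSup hbdd haT).trans hs.le, hsb⟩, h'⟩
  linarith

theorem exists_level_growth_le {X : Type*} [MeasurableSpace X] (ν : Measure X) [IsFiniteMeasure ν]
    {u : X → ℝ} (hu : Measurable u) {U : Set X} (hU : MeasurableSet U) {a b : ℝ} (hab : a < b)
    {e : ℝ≥0} (he : ν U < e) :
    ∃ σ, a ≤ σ ∧ σ < b ∧ ∀ s, σ < s → s ≤ b →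
      ν (U ∩ {y | σ < u y ∧ u y < s}) ≤ ENNReal.ofReal (e / (b - a) * (s - σ)) := by
  have hmono : Monotone fun t => ν.real (U ∩ {y | u y ≤ t}) := fun s t hst =>
    measureReal_mono (inter_subset_inter_right _ fun y hy => le_trans hy hst)
  have hlt : ν.real (U ∩ {y | u y ≤ b}) - ν.real (U ∩ {y | u y ≤ a}) < e / (b - a) * (b - a) := by
    rw [div_mul_cancel₀ _ (sub_pos.mpr hab).ne']
    have h1 : ν.real (U ∩ {y | u y ≤ b}) ≤ ν.real U := measureReal_mono inter_subset_left
    have h2 : ν.real U < e := ENNReal.toReal_lt_of_lt_ofReal (by simpa using he)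
    linarith [measureReal_nonneg (μ := ν) (s := U ∩ {y | u y ≤ a})]
  obtain ⟨σ, h1, h2, h3⟩ := exists_growth_le hmono hab hlt
  refine ⟨σ, h1, h2, fun s hs hsb => ?_⟩
  rw [← ofReal_measureReal]
  refine ENNReal.ofReal_le_ofReal (le_trans ?_ (h3 s hs hsb))
  rw [le_sub_iff_add_le, ← measureReal_union _ (hU.inter (measurableSet_le hu measurable_const))]
  · refine measureReal_mono ?_
    rintro y (hy | hy)
    · exact ⟨hy.1, hy.2.2.le⟩
    · exact ⟨hy.1, hy.2.trans hs.le⟩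
  · exact disjoint_left.mpr fun y hy hy' => absurd hy.2.1 (not_lt.mpr hy'.2)

variable {μ : Measure X} {Cd : ℝ≥0} {CP lam : ℝ}

/-- If both `E` and its complement have density more than `1 / 2` at arbitrarily small scales,
then at arbitrarily small scales neither of them has small density. -/
theorem DoublingWith.frequently_balanced (hμ : DoublingWith μ Cd) {E : Set X}
    (hE : MeasurableSet E) {x : X}
    (h1 : ∃ᶠ r in 𝓝[>] (0 : ℝ), μ (ball x r) < 2 * μ (ball x r ∩ E))
    (h2 : ∃ᶠ r in 𝓝[>] (0 : ℝ), μ (ball x r) < 2 * μ (ball x r \ E)) :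
    ∃ᶠ r in 𝓝[>] (0 : ℝ), μ (ball x r) ≤ 2 * μ (ball x r ∩ E) ∧
      μ (ball x r) ≤ 2 * Cd * μ (ball x r \ E) := by
  intro hcon
  obtain ⟨δ, hδ, hsub⟩ := mem_nhdsGT_iff_exists_Ioo_subset.mp hcon
  obtain ⟨r, hr, hr0, hrδ⟩ := (h1.and_eventually (Ioo_mem_nhdsGT hδ)).exists
  obtain ⟨ρ, hρ, hρ0, hρr⟩ := (h2.and_eventually (Ioo_mem_nhdsGT hr0)).exists
  have hk : ∃ k : ℕ, μ (ball x ((1 / 2) ^ k * r)) ≤ 2 * Cd * μ (ball x ((1 / 2) ^ k * r) \ E) := by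
    obtain ⟨k, hk1, hk2⟩ := exists_nat_pow_near_of_lt_one (x := ρ / r) (y := 1 / 2) (by positivity)
      ((div_le_one hr0).mpr hρr.le) (by norm_num) (by norm_num)
    rw [lt_div_iff₀ hr0, pow_succ] at hk1
    rw [div_le_iff₀ hr0] at hk2
    refine ⟨k, ?_⟩
    calc μ (ball x ((1 / 2) ^ k * r)) ≤ μ (ball x (2 * ρ)) :=
          measure_mono (ball_subset_ball (by linarith))
      _ ≤ Cd * μ (ball x ρ) := (hμ x ρ hρ0).2.1
      _ ≤ Cd * (2 * μ (ball x ρ \ E)) := by gcongr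
      _ = 2 * Cd * μ (ball x ρ \ E) := by ring
      _ ≤ _ := by gcongr
  classical
  set k := Nat.find hk with hkdef
  have hspec := Nat.find_spec hk
  rw [← hkdef] at hspec
  have hrk : (1 / 2) ^ k * r < δ :=
    (mul_le_of_le_one_left hr0.le (pow_le_one₀ (by norm_num) (by norm_num))).trans_lt hrδ
  have hrk0 : 0 < (1 / 2) ^ k * r := by positivity
  refine hsub ⟨hrk0, hrk⟩ ⟨?_, hspec⟩
  rcases Nat.eq_zero_or_eq_succ_pred k with h0 | h0
  · rw [h0, pow_zero, one_mul]
    exact hr.le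
  set j := k.pred
  have hj := Nat.find_min hk (m := j) (by rw [← hkdef, h0]; exact Nat.lt_succ_self j)
  rw [not_le] at hj
  have hj2 : (1 / 2 : ℝ) ^ j * r = 2 * ((1 / 2) ^ k * r) := by
    rw [h0, Nat.succ_eq_add_one, pow_succ]
    ring
  rw [hj2] at hj
  set B := ball x ((1 / 2) ^ k * r) with hB
  have hBtop : μ B ≠ ⊤ := hμ.measure_ball_ne_top x hrk0
  have h3 : Cd * (2 * μ (B \ E)) < Cd * μ B := by
    calc Cd * (2 * μ (B \ E)) = 2 * Cd * μ (B \ E) := by ring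
      _ ≤ 2 * Cd * μ (ball x (2 * ((1 / 2) ^ k * r)) \ E) := by
          gcongr
          exact ball_subset_ball (by linarith)
      _ < _ := hj
      _ ≤ _ := (hμ x _ hrk0).2.1
  have h4 : 2 * μ (B \ E) ≤ μ B := (lt_of_mul_lt_mul_left' h3).le
  have h5 := measure_inter_add_sdiff (μ := μ) B hE
  refine (ENNReal.add_le_add_iff_right hBtop).mp ?_
  calc μ B + μ B = 2 * μ (B ∩ E) + 2 * μ (B \ E) := by rw [← mul_add, h5, two_mul]
    _ ≤ _ := by gcongr

theorem PoincareIneq.frequently_measure_div_le [BorelSpace X] (hP : PoincareIneq μ CP lam)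
    (hCP : 0 ≤ CP) (hlam : 1 ≤ lam) (hμ : DoublingWith μ Cd) {u : X → ℝ} {g : X → ℝ≥0∞}
    (hu : Measurable u) (hg : IsUpperGradient g u) (hgi : ∫⁻ y, g y ∂μ ≠ ⊤) {σ : ℝ} {x : X}
    (h1 : ∃ᶠ r in 𝓝[>] (0 : ℝ), μ (ball x r) < 2 * μ (ball x r ∩ {y | σ < u y}))
    (h2 : ∃ᶠ r in 𝓝[>] (0 : ℝ), μ (ball x r) < 2 * μ (ball x r ∩ {y | u y ≤ σ})) :
    ∃ᶠ r in 𝓝[>] (0 : ℝ), ∀ᶠ s in 𝓝[>] σ, μ (ball x r) / ENNReal.ofReal r ≤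
      8 * Cd * ENNReal.ofReal CP * (ENNReal.ofReal (s - σ)⁻¹ *
        μ.withDensity g (closedBall x (lam * r) ∩ {y | σ < u y ∧ u y < s})) := by
  have hE : MeasurableSet {y | σ < u y} := measurableSet_lt measurable_const hu
  have hcompl : ∀ B : Set X, B \ {y | σ < u y} = B ∩ {y | u y ≤ σ} := fun B => by
    ext y
    simp
  have hbal := hμ.frequently_balanced hE h1 (by simpa only [hcompl] using h2)
  refine (hbal.and_eventually self_mem_nhdsWithin).mono ?_
  rintro r ⟨⟨hr1, hr2⟩, hr0⟩
  have hr0 : 0 < r := hr0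
  rw [hcompl] at hr2
  have hB := hμ.measure_ball_ne_zero x hr0
  have hB' := hμ.measure_ball_ne_top x hr0
  have hCd : (Cd : ℝ≥0∞) ≠ 0 := by
    intro h
    rw [h, mul_zero, zero_mul] at hr2
    exact hB (nonpos_iff_eq_zero.mp hr2)
  have hev : ∀ᶠ s in 𝓝[>] σ, μ (ball x r) ≤ 4 * μ (ball x r ∩ {y | s ≤ u y}) := by
    have hmono : Monotone fun n : ℕ => ball x r ∩ {y | σ + 1 / ((n : ℝ) + 1) ≤ u y} :=
      fun n k hnk => inter_subset_inter_right _ fun y (hy : σ + 1 / ((n : ℝ) + 1) ≤ u y) =>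
        (by linarith [Nat.one_div_le_one_div (α := ℝ) hnk] : σ + 1 / ((k : ℝ) + 1) ≤ u y)
    have hU : ball x r ∩ {y | σ < u y} ⊆ ⋃ n : ℕ, ball x r ∩ {y | σ + 1 / ((n : ℝ) + 1) ≤ u y} := by
      intro y hy
      obtain ⟨n, hn⟩ := exists_nat_one_div_lt (sub_pos.mpr (show σ < u y from hy.2))
      exact mem_iUnion.mpr ⟨n, hy.1, (by linarith : σ + 1 / ((n : ℝ) + 1) ≤ u y)⟩
    have hsup := (measure_mono (μ := μ) hU).trans_eq hmono.measure_iUnion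
    obtain ⟨n, hn⟩ : ∃ n : ℕ, μ (ball x r) ≤
        4 * μ (ball x r ∩ {y | σ + 1 / ((n : ℝ) + 1) ≤ u y}) := by
      by_contra! hcon
      have h3 : 4 * μ (ball x r ∩ {y | σ < u y}) ≤ μ (ball x r) := by
        refine (mul_le_mul_right hsup 4).trans ?_
        rw [ENNReal.mul_iSup]
        exact iSup_le fun n => (hcon n).le
      have h4 : 2 * μ (ball x r) ≤ 1 * μ (ball x r) := by
        rw [one_mul]
        refine le_trans ?_ h3
        calc 2 * μ (ball x r) ≤ 2 * (2 * μ (ball x r ∩ {y | σ < u y})) := by gcongr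
          _ = _ := by ring
      rw [ENNReal.mul_le_mul_iff_left hB hB'] at h4
      norm_num at h4
    filter_upwards [Ioo_mem_nhdsGT (show σ < σ + 1 / ((n : ℝ) + 1) by
      have : (0 : ℝ) < 1 / ((n : ℝ) + 1) := by positivity
      linarith)] with s hs
    refine hn.trans ?_
    gcongr
    exact hs.2.le
  filter_upwards [hev, self_mem_nhdsWithin] with s hs hsσ
  have hsσ : σ < s := hsσ
  have hθ : (2 * Cd : ℝ≥0∞)⁻¹ * μ (ball x r) ≤ μ (ball x r ∩ {y | u y ≤ σ}) := by
    rw [← ENNReal.div_eq_inv_mul]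
    refine ENNReal.div_le_of_le_mul ?_
    rwa [mul_comm]
  have hmain := hP.measure_superlevel_le hlam hμ hu hg hgi x hr0 hsσ hθ
  set I := ∫⁻ y in ball x (lam * r) ∩ {y | σ < u y ∧ u y < s}, g y ∂μ
  have hI : I ≤ μ.withDensity g (closedBall x (lam * r) ∩ {y | σ < u y ∧ u y < s}) := by
    refine le_trans ?_ (withDensity_apply_le g _)
    exact lintegral_mono_set (inter_subset_inter_left _ ball_subset_closedBall)
  refine ENNReal.div_le_of_le_mul ?_
  calc μ (ball x r) ≤ 4 * μ (ball x r ∩ {y | s ≤ u y}) := hs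
    _ = 4 * (2 * Cd) * ((2 * Cd : ℝ≥0∞)⁻¹ * μ (ball x r ∩ {y | s ≤ u y})) := by
        rw [← mul_assoc, mul_assoc 4, ENNReal.mul_inv_cancel (by simpa using hCd) (by finiteness),
          mul_one]
    _ ≤ 4 * (2 * Cd) * (ENNReal.ofReal (CP * r) * (ENNReal.ofReal (s - σ)⁻¹ * I)) := by gcongr
    _ = 8 * Cd * ENNReal.ofReal CP * (ENNReal.ofReal (s - σ)⁻¹ * I) * ENNReal.ofReal r := by
        rw [ENNReal.ofReal_mul hCP]
        ring
    _ ≤ _ := by gcongr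

end Oscillation

section OscillationCapacity

variable {μ : Measure X} {Cd : ℝ≥0} {CP lam : ℝ}

/-- The points where both `{b < u}` and `{u < a}` have density more than `1 / 2` at arbitrarily
small scales. -/
def oscExceptional (μ : Measure X) (u : X → ℝ) (a b : ℝ) : Set X :=
  {x | (∃ᶠ r in 𝓝[>] (0 : ℝ), μ (ball x r) < 2 * μ (ball x r ∩ {y | b < u y})) ∧
    ∃ᶠ r in 𝓝[>] (0 : ℝ), μ (ball x r) < 2 * μ (ball x r ∩ {y | u y < a})}

theorem DoublingWith.ae_not_frequently [BorelSpace X] (hμ : DoublingWith μ Cd)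
    {E : Set X} (hE : MeasurableSet E) :
    ∀ᵐ x ∂μ, x ∉ E → ¬ ∃ᶠ r in 𝓝[>] (0 : ℝ), μ (ball x r) < 2 * μ (ball x r ∩ E) := by
  filter_upwards [hμ.ae_eventually_measure_inter_le hE (η := 2⁻¹) (by simp)] with x hx hxE
  rw [not_frequently]
  filter_upwards [hx hxE] with r hr
  refine not_lt.mpr ((mul_le_mul_right hr 2).trans ?_)
  rw [← mul_assoc, ENNReal.mul_inv_cancel (by simp) (by simp), one_mul]

theorem DoublingWith.measure_oscExceptional [BorelSpace X] (hμ : DoublingWith μ Cd)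
    {u : X → ℝ} (hu : Measurable u) {a b : ℝ} (hab : a < b) :
    μ (oscExceptional μ u a b) = 0 := by
  rw [measure_eq_zero_iff_ae_notMem]
  filter_upwards [hμ.ae_not_frequently (measurableSet_lt measurable_const hu :
    MeasurableSet {y | b < u y}), hμ.ae_not_frequently (measurableSet_lt hu measurable_const :
    MeasurableSet {y | u y < a})] with x h1 h2 hx
  rcases le_or_gt (u x) b with h | h
  · exact h1 (not_lt.mpr h) hx.1
  · exact h2 (not_lt.mpr (hab.trans h).le) hx.2

theorem sum_measure_inter_closedBall_le (ν : Measure X) [BorelSpace X] {U : Set X}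
    (F : Finset X) (ρ : X → ℝ) (hF : (F : Set X).PairwiseDisjoint fun x => closedBall x (ρ x))
    (hU : ∀ x ∈ F, closedBall x (ρ x) ⊆ U) {E : Set X} (hE : MeasurableSet E) :
    ∑ x ∈ F, ν (closedBall x (ρ x) ∩ E) ≤ ν (U ∩ E) := by
  rw [← measure_biUnion_finset (fun x hx y hy hxy =>
    (hF hx hy hxy).mono inter_subset_left inter_subset_left)
    fun x _ => measurableSet_closedBall.inter hE]
  exact measure_mono (iUnion₂_subset fun x hx => inter_subset_inter_left _ (hU x hx))

theorem PoincareIneq.capacity1_oscExceptional [BorelSpace X] (hP : PoincareIneq μ CP lam)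
    (hCP : 0 ≤ CP) (hlam : 1 ≤ lam) (hμ : DoublingWith μ Cd) {u : X → ℝ} {g : X → ℝ≥0∞}
    (hu : Measurable u) (hg : IsUpperGradient g u) (hgi : ∫⁻ y, g y ∂μ ≠ ⊤) {a b : ℝ}
    (hab : a < b) : capacity1 μ (oscExceptional μ u a b) = 0 := by
  have := hμ.secondCountableTopology
  have hfin : IsFiniteMeasure (μ.withDensity g) := isFiniteMeasure_withDensity hgi
  set ν := μ.withDensity g with hν
  have hlam0 : 0 < lam := one_pos.trans_le hlam
  obtain ⟨K, hK⟩ := hμ.exists_capacity1_closedBall_le (5 * lam) (by positivity)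
  set M : ℝ≥0∞ := K * (8 * Cd * ENNReal.ofReal CP) with hM
  have hνO : ν (oscExceptional μ u a b) = 0 :=
    withDensity_absolutelyContinuous _ _ (hμ.measure_oscExceptional hu hab)
  refine ennreal_eq_zero_of_forall_le_mul (K := M * ENNReal.ofReal (b - a)⁻¹) (by finiteness)
    fun ε hε => ?_
  obtain ⟨U, hOU, hUo, hUε⟩ := (oscExceptional μ u a b).exists_isOpen_lt_of_lt ε (hνO ▸ hε)
  obtain ⟨e, hUe, heε⟩ := ENNReal.lt_iff_exists_nnreal_btwn.mp hUε
  obtain ⟨σ, haσ, hσb, hσ⟩ := exists_level_growth_le ν hu hUo.measurableSet hab hUe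
  have hball : ∀ x ∈ oscExceptional μ u a b, ∃ r : ℝ, 0 < r ∧ lam * r ≤ 1 ∧
      closedBall x (lam * r) ⊆ U ∧ ∀ᶠ s in 𝓝[>] σ, μ (ball x r) / ENNReal.ofReal r ≤
        8 * Cd * ENNReal.ofReal CP * (ENNReal.ofReal (s - σ)⁻¹ *
          ν (closedBall x (lam * r) ∩ {y | σ < u y ∧ u y < s})) := by
    intro x hx
    obtain ⟨δ, hδ, hδU⟩ := Metric.isOpen_iff.mp hUo x (hOU hx)
    obtain ⟨r, hr, hr0, hrδ⟩ := ((hP.frequently_measure_div_le hCP hlam hμ hu hg hgi (σ := σ)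
      (hx.1.mono fun r hr => hr.trans_le (by gcongr))
      (hx.2.mono fun r hr => hr.trans_le (by
        gcongr
        exact fun hy => (lt_of_lt_of_le hy haσ).le))).and_eventually
      (Ioo_mem_nhdsGT (show 0 < min δ 1 / lam by positivity))).exists
    rw [lt_div_iff₀ hlam0, mul_comm] at hrδ
    exact ⟨r, hr0, (hrδ.trans_le (min_le_right _ _)).le,
      (closedBall_subset_ball (hrδ.trans_le (min_le_left _ _))).trans hδU, hr⟩
  choose! r hr0 hr1 hrU hr using hball
  obtain ⟨S, hSO, -, hSd, hSle⟩ := hμ.exists_capacity1_le_tsum (oscExceptional μ u a b)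
    (fun x => lam * r x) (fun x hx => mul_pos hlam0 (hr0 x hx)) hr1
  refine hSle.trans ?_
  rw [ENNReal.tsum_eq_iSup_sum]
  refine iSup_le fun F => ?_
  have hev : ∀ᶠ s in 𝓝[>] σ, ∀ x ∈ F, μ (ball (x : X) (r x)) / ENNReal.ofReal (r x) ≤
        8 * Cd * ENNReal.ofReal CP * (ENNReal.ofReal (s - σ)⁻¹ *
          ν (closedBall (x : X) (lam * r x) ∩ {y | σ < u y ∧ u y < s})) :=
    (Finset.eventually_all F).mpr fun x _ => hr x (hSO x.2)
  obtain ⟨s, hs, hσs, hsb⟩ := (hev.and (Ioo_mem_nhdsGT hσb)).exists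
  have hσs0 : 0 < s - σ := sub_pos.mpr hσs
  set E : Set X := {y | σ < u y ∧ u y < s} with hEdef
  have hE : MeasurableSet E :=
    (measurableSet_lt measurable_const hu).inter (measurableSet_lt hu measurable_const)
  have hsum : ∑ x ∈ F, ν (closedBall (x : X) (lam * r x) ∩ E) ≤ ν (U ∩ E) := by
    have hmap := Finset.sum_map F (Function.Embedding.subtype (· ∈ S))
      fun x => ν (closedBall x (lam * r x) ∩ E)
    refine hmap.symm.trans_le ?_
    have hFS : ∀ x ∈ F.map (Function.Embedding.subtype (· ∈ S)), x ∈ S := fun x hx => by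
      obtain ⟨y, -, rfl⟩ := Finset.mem_map.mp hx
      exact y.2
    exact sum_measure_inter_closedBall_le ν _ (fun x => lam * r x)
      (hSd.subset fun x hx => hFS x hx) (fun x hx => hrU x (hSO (hFS x hx))) hE
  calc ∑ x ∈ F, capacity1 μ (oscExceptional μ u a b ∩ closedBall (x : X) (5 * (lam * r x)))
      ≤ ∑ x ∈ F, M * (ENNReal.ofReal (s - σ)⁻¹ * ν (closedBall (x : X) (lam * r x) ∩ E)) := by
        refine Finset.sum_le_sum fun x hx => ?_
        have hx0 := hr0 x (hSO x.2)
        have hx1 := hr1 x (hSO x.2)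
        refine (capacity1_mono μ inter_subset_right).trans ?_
        rw [← mul_assoc 5]
        refine (hK x (r x) hx0 (by nlinarith)).trans ?_
        rw [hM, mul_assoc]
        gcongr
        exact hs x hx
    _ = M * (ENNReal.ofReal (s - σ)⁻¹ * ∑ x ∈ F, ν (closedBall (x : X) (lam * r x) ∩ E)) := by
        rw [Finset.mul_sum, Finset.mul_sum]
    _ ≤ M * (ENNReal.ofReal (s - σ)⁻¹ * ENNReal.ofReal (e / (b - a) * (s - σ))) := by
        gcongr
        exact hsum.trans (hσ s hσs hsb.le)
    _ = M * ENNReal.ofReal (b - a)⁻¹ * e := by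
        rw [← ENNReal.ofReal_mul (by positivity), mul_assoc M, ← ENNReal.ofReal_coe_nnreal (p := e),
          ← ENNReal.ofReal_mul (by simpa using hab.le)]
        congr 2
        field_simp
    _ ≤ _ := by gcongr

end OscillationCapacity

section FineClosure

variable {μ : Measure X} {Cd : ℝ≥0} {CP lam : ℝ}

theorem ramp_le_inv_mul {b z : ℝ} (hb0 : 0 < b) (hb1 : b < 1) (hz : 0 ≤ z) :
    ramp b 1 z ≤ b⁻¹ * z := by
  rcases le_or_gt z b with h | h
  · rw [ramp_eq_zero hb1 h]
    positivity
  · refine (ramp_le_one _ _ _).trans ?_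
    rw [inv_mul_eq_div, le_div_iff₀ hb0]
    linarith

/-- The set where a test function is at least `1`, together with a set of zero capacity, is thin
at points where the test function has a smaller approximate upper limit. -/
theorem PoincareIneq.oneThinAt_superlevel [BorelSpace X] (hP : PoincareIneq μ CP lam)
    (hlam : 1 ≤ lam) (hμ : DoublingWith μ Cd) {u : X → ℝ} {g : X → ℝ≥0∞}
    (hu : Measurable u) (hg : IsUpperGradient g u) (hu0 : ∀ y, 0 ≤ u y)
    (hui : ∫⁻ y, ENNReal.ofReal (u y) ∂μ ≠ ⊤) (hgi : ∫⁻ y, g y ∂μ ≠ ⊤) {b : ℝ} (hb0 : 0 < b)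
    (hb1 : b < 1) {N : Set X} (hN : capacity1 μ N = 0) {x : X} (hx : x ∉ gradExceptional μ g)
    (hdens : ∀ᶠ r in 𝓝[>] (0 : ℝ), 2 * μ (ball x r ∩ {y | b < u y}) ≤ μ (ball x r)) :
    OneThinAt μ ({y | 1 ≤ u y} ∪ N) x := by
  have hx := not_not.mp hx
  have hlam0 : 0 < lam := one_pos.trans_le hlam
  have hten : ∀ L : ℝ, 0 < L → Tendsto (fun r : ℝ => L * r) (𝓝[>] 0) (𝓝[>] 0) := by
    intro L hL
    refine tendsto_nhdsWithin_iff.mpr ⟨?_, eventually_nhdsWithin_of_forall fun r hr => ?_⟩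
    · have : Tendsto (fun r : ℝ => L * r) (𝓝 0) (𝓝 (L * 0)) := tendsto_id.const_mul L
      rw [mul_zero] at this
      exact this.mono_left nhdsWithin_le_nhds
    · exact mul_pos hL hr
  obtain ⟨K, hK⟩ := hμ.exists_measure_ball_mul_le (2 * lam)
  set κ : ℝ≥0∞ := ENNReal.ofReal |1 - b|⁻¹ with hκ
  set c : ℝ≥0∞ := (2 + ENNReal.ofReal (4 * CP)) * κ * K with hc
  have hlim := ENNReal.Tendsto.const_mul (a := c) (hx.comp (hten (2 * lam) (by positivity)))
    (Or.inr (by finiteness))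
  rw [mul_zero] at hlim
  refine tendsto_of_tendsto_of_tendsto_of_le_of_le' tendsto_const_nhds hlim
    (Eventually.of_forall fun _ => zero_le) ?_
  filter_upwards [(hten 2 two_pos).eventually hdens, self_mem_nhdsWithin] with r hr hr0
  have hr0 : 0 < r := hr0
  have h2r : 0 < 2 * r := by positivity
  have hLr : 0 < 2 * lam * r := by positivity
  have hwm : Measurable fun y => ramp b 1 (u y) := (measurable_ramp b 1).comp hu
  have hwi : ∫⁻ y, ENNReal.ofReal (ramp b 1 (u y)) ∂μ ≠ ⊤ := by
    have hle : ∫⁻ y, ENNReal.ofReal (ramp b 1 (u y)) ∂μ ≤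
        ∫⁻ y, ENNReal.ofReal b⁻¹ * ENNReal.ofReal (u y) ∂μ := by
      refine lintegral_mono fun y => ?_
      rw [← ENNReal.ofReal_mul (by positivity)]
      exact ENNReal.ofReal_le_ofReal (ramp_le_inv_mul hb0 hb1 (hu0 y))
    rw [lintegral_const_mul _ hu.ennreal_ofReal] at hle
    exact ne_top_of_le_ne_top (by finiteness) hle
  have hgwi : ∫⁻ y, κ * g y ∂μ ≠ ⊤ := by
    rw [lintegral_const_mul _ hg.1]
    finiteness
  have hcap := relCapacity1_le μ (A := {y | 1 ≤ u y}) hwm (hg.ramp_comp b 1)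
    (fun _ => ramp_nonneg _ _ _) (fun y hy => (ramp_eq_one hb1 hy).ge) hN hwi hgwi x hr0
  have hw := hP.mul_setLIntegral_le hlam hμ hwm (hg.ramp_comp b 1)
    (fun _ => ramp_nonneg _ _ _) (fun _ => ramp_le_one _ _ _) x h2r (θ := 2⁻¹)
    ((inv_two_mul_le_of_two_mul_inter_le (measurableSet_lt measurable_const hu)
      (hμ.measure_ball_ne_top x h2r) hr).trans
      (measure_mono fun y hy => ⟨hy.1, ramp_eq_zero hb1 (not_lt.mp hy.2)⟩))
  rw [lintegral_const_mul _ hg.1] at hw hcap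
  rw [← mul_assoc lam, mul_comm lam 2] at hw
  set W := ∫⁻ y in ball x (2 * r), ENNReal.ofReal (ramp b 1 (u y)) ∂μ
  set I := ∫⁻ y in ball x (2 * lam * r), g y ∂μ with hI
  have hII : ∫⁻ y in ball x (2 * r), g y ∂μ ≤ I :=
    lintegral_mono_set (ball_subset_ball (by nlinarith))
  have hW : W ≤ 2 * (ENNReal.ofReal (CP * (2 * r)) * (κ * I)) := by
    calc W = 2 * (2⁻¹ * W) := by
          rw [← mul_assoc, ENNReal.mul_inv_cancel (by simp) (by simp), one_mul]
      _ ≤ _ := by gcongr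
  have hcoef : ENNReal.ofReal r⁻¹ * (2 * ENNReal.ofReal (CP * (2 * r))) =
      ENNReal.ofReal (4 * CP) := by
    rw [← ENNReal.ofReal_ofNat 2, ← ENNReal.ofReal_mul zero_le_two,
      ← ENNReal.ofReal_mul (by positivity)]
    congr 1
    field_simp
    ring
  have hrel : relCapacity1 μ (({y | 1 ≤ u y} ∪ N) ∩ ball x r) (ball x (2 * r)) ≤
      (2 + ENNReal.ofReal (4 * CP)) * κ * I := by
    calc _ ≤ 2 * (κ * ∫⁻ y in ball x (2 * r), g y ∂μ) + ENNReal.ofReal r⁻¹ * W := hcap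
      _ ≤ 2 * (κ * I) + ENNReal.ofReal r⁻¹ *
          (2 * (ENNReal.ofReal (CP * (2 * r)) * (κ * I))) := by gcongr
      _ = 2 * (κ * I) + ENNReal.ofReal r⁻¹ * (2 * ENNReal.ofReal (CP * (2 * r))) * (κ * I) := by
          ring
      _ = _ := by
          rw [hcoef]
          ring
  have hinv : (μ (ball x r))⁻¹ ≤ K * (μ (ball x (2 * lam * r)))⁻¹ := by
    rw [← div_eq_mul_inv, ENNReal.le_div_iff_mul_le
      (Or.inl (hμ.measure_ball_ne_zero x hLr)) (Or.inl (hμ.measure_ball_ne_top x hLr)), mul_comm,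
      ← div_eq_mul_inv]
    exact ENNReal.div_le_of_le_mul (hK x r hr0)
  calc ENNReal.ofReal r * relCapacity1 μ (({y | 1 ≤ u y} ∪ N) ∩ ball x r) (ball x (2 * r)) /
        μ (ball x r)
      ≤ ENNReal.ofReal r * ((2 + ENNReal.ofReal (4 * CP)) * κ * I) *
          (K * (μ (ball x (2 * lam * r)))⁻¹) := by
        rw [div_eq_mul_inv]
        gcongr
    _ ≤ ENNReal.ofReal (2 * lam * r) * ((2 + ENNReal.ofReal (4 * CP)) * κ * I) *
          (K * (μ (ball x (2 * lam * r)))⁻¹) := by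
        gcongr
        nlinarith
    _ = c * (ENNReal.ofReal (2 * lam * r) * (I / μ (ball x (2 * lam * r)))) := by
        rw [hc, div_eq_mul_inv]
        ring

/-- The points at which `u` does not behave like an approximately continuous function. -/
def fineExceptional (μ : Measure X) (u : X → ℝ) (g : X → ℝ≥0∞) : Set X :=
  gradExceptional μ g ∪ ⋃ p : {p : ℚ × ℚ // p.1 < p.2},
    (lowExceptional μ u p.1.1 p.1.2 ∪ oscExceptional μ u p.1.1 p.1.2)

theorem PoincareIneq.capacity1_fineExceptional [BorelSpace X] (hP : PoincareIneq μ CP lam)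
    (hCP : 0 ≤ CP) (hlam : 1 ≤ lam) (hμ : DoublingWith μ Cd) {u : X → ℝ} {g : X → ℝ≥0∞}
    (hu : Measurable u) (hg : IsUpperGradient g u) (hgi : ∫⁻ y, g y ∂μ ≠ ⊤) :
    capacity1 μ (fineExceptional μ u g) = 0 := by
  refine nonpos_iff_eq_zero.mp ((capacity1_union_le μ _ _).trans ?_)
  rw [hμ.capacity1_gradExceptional hg.1 hgi, zero_add]
  refine (capacity1_iUnion_eq_zero fun p => ?_).le
  have hp : ((p.1.1 : ℚ) : ℝ) < (p.1.2 : ℚ) := Rat.cast_lt.mpr p.2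
  refine nonpos_iff_eq_zero.mp ((capacity1_union_le μ _ _).trans ?_)
  rw [hP.capacity1_lowExceptional hCP hlam hμ hu hg hgi hp,
    hP.capacity1_oscExceptional hCP hlam hμ hu hg hgi hp, add_zero]

theorem PoincareIneq.oneFinelyClosed_superlevel [BorelSpace X] (hP : PoincareIneq μ CP lam)
    (hCP : 0 ≤ CP) (hlam : 1 ≤ lam) (hμ : DoublingWith μ Cd) {u : X → ℝ} {g : X → ℝ≥0∞}
    (hu : Measurable u) (hg : IsUpperGradient g u) (hu0 : ∀ y, 0 ≤ u y)
    (hui : ∫⁻ y, ENNReal.ofReal (u y) ∂μ ≠ ⊤) (hgi : ∫⁻ y, g y ∂μ ≠ ⊤) :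
    OneFinelyClosed μ ({y | 1 ≤ u y} ∪ fineExceptional μ u g) := by
  intro x hx
  rw [compl_compl]
  simp only [fineExceptional, mem_compl_iff, mem_union, mem_iUnion, not_or, not_exists] at hx
  obtain ⟨hx1, hxg, hxe⟩ := hx
  obtain ⟨p, hp1, hp2⟩ := exists_rat_btwn (not_le.mp hx1 : u x < 1)
  obtain ⟨q, hq1, hq2⟩ := exists_rat_btwn hp2
  obtain ⟨b, hb1, hb2⟩ := exists_rat_btwn hq2
  have hlow := (hxe ⟨(p, q), Rat.cast_lt.mp hq1⟩).1
  have hosc := (hxe ⟨(q, b), Rat.cast_lt.mp hb1⟩).2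
  refine hP.oneThinAt_superlevel hlam hμ hu hg hu0 hui hgi (b := b)
    ((hu0 x).trans_lt (hp1.trans (hq1.trans hb1))) hb2
    (hP.capacity1_fineExceptional hCP hlam hμ hu hg hgi) hxg ?_
  have hfreq : ∃ᶠ r in 𝓝[>] (0 : ℝ), μ (ball x r) < 2 * μ (ball x r ∩ {y | u y < q}) := by
    intro hcon
    exact hlow ⟨hp1.le, hcon.mono fun r hr => not_lt.mp hr⟩
  by_contra hcon
  exact hosc ⟨(not_eventually.mp hcon).mono fun r hr => not_le.mp hr, hfreq⟩

theorem PoincareIneq.capacity1_oneFineClosure_le [BorelSpace X] (hP : PoincareIneq μ CP lam)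
    (hCP : 0 ≤ CP) (hlam : 1 ≤ lam) (hμ : DoublingWith μ Cd) (G : Set X) :
    capacity1 μ (oneFineClosure μ G) ≤ capacity1 μ G := by
  refine le_of_forall_gt fun c hc => ?_
  obtain ⟨u, g, hu, hg, hu0, -, hG, hlt⟩ := exists_capacity_test hc
  have hfin : eL1Norm μ u + ∫⁻ y, g y ∂μ ≠ ⊤ := hlt.ne_top
  have hgi := (ENNReal.add_ne_top.mp hfin).2
  have hui : ∫⁻ y, ENNReal.ofReal (u y) ∂μ ≠ ⊤ := by
    refine ne_top_of_le_ne_top (ENNReal.add_ne_top.mp hfin).1 (lintegral_mono fun y => ?_)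
    exact ENNReal.ofReal_le_ofReal (le_abs_self _)
  have hsub : oneFineClosure μ G ⊆ {y | 1 ≤ u y} ∪ fineExceptional μ u g :=
    sInter_subset_of_mem ⟨fun y hy => Or.inl (hG y hy),
      hP.oneFinelyClosed_superlevel hCP hlam hμ hu hg hu0 hui hgi⟩
  calc capacity1 μ (oneFineClosure μ G)
      ≤ capacity1 μ {y | 1 ≤ u y} + capacity1 μ (fineExceptional μ u g) :=
        (capacity1_mono μ hsub).trans (capacity1_union_le μ _ _)
    _ = capacity1 μ {y | 1 ≤ u y} := by
        rw [hP.capacity1_fineExceptional hCP hlam hμ hu hg hgi, add_zero]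
    _ ≤ eL1Norm μ u + ∫⁻ y, g y ∂μ := capacity1_le μ hu hg fun y hy => hy
    _ < c := hlt

end FineClosure
/-- **Proposition.** There is a constant `C ≥ 1`, depending only on the doubling
constant `Cd` and the Poincaré constants `CP`, `lam`, such that
`cap₁(G̅¹) ≤ C · cap₁(G)` for every `G ⊆ X`, where `G̅¹` is the `1`-fine closure. -/
theorem capacity_oneFineClosure
    (Cd : ℝ≥0) (CP lam : ℝ) (hCd : 1 ≤ Cd) (hCP : 0 < CP) (hlam : 1 ≤ lam) :
    ∃ C : ℝ≥0, 1 ≤ C ∧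
      ∀ (X : Type) [MetricSpace X] [CompleteSpace X] [Nontrivial X]
        [MeasurableSpace X] [BorelSpace X] (μ : Measure X),
        DoublingWith μ Cd → PoincareIneq μ CP lam →
        ∀ G : Set X,
          capacity1 μ (oneFineClosure μ G) ≤ (C : ℝ≥0∞) * capacity1 μ G := by
  refine ⟨1, le_rfl, fun X _ _ _ _ _ μ hμ hP G => ?_⟩
  rw [ENNReal.coe_one, one_mul]
  exact hP.capacity1_oneFineClosure_le hCP.le hlam hμ G

end FineBV
end
end

section
/- There is a constant C ≥ 1 depending only on the doubling constant C_d and the Poincaré constants C_P, λ such that the following holds. Let x ∈ X, r > 0, and let G ⊂ X be a μ-measurable set with μ(G ∩ B(x,2r))/μ(B(x,2r)) ≤ 1/(2 C_d^{⌈log₂(128λ)⌉}). Then relcap₁(I_G ∩ B(x,r), B(x,2r)) ≤ C P(G, B(x,2r)). -/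
open MeasureTheory Metric Set Filter Topology ENNReal NNReal

noncomputable section

namespace FineBV

variable {X : Type*} [MetricSpace X] [MeasurableSpace X]

/-- Iterated doubling. -/
theorem DoublingWith.measure_ball_two_pow_mul_le {μ : Measure X} {Cd : ℝ≥0}
    (hμ : DoublingWith μ Cd) (x : X) {r : ℝ} (hr : 0 < r) (n : ℕ) :
    μ (ball x (2 ^ n * r)) ≤ (Cd : ℝ≥0∞) ^ n * μ (ball x r) := by
  induction n with
  | zero => simp
  | succ n ih =>
    calc μ (ball x (2 ^ (n + 1) * r)) = μ (ball x (2 * (2 ^ n * r))) := by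
          rw [pow_succ']; ring_nf
      _ ≤ Cd * μ (ball x (2 ^ n * r)) := (hμ x _ (by positivity)).2.1
      _ ≤ Cd * ((Cd : ℝ≥0∞) ^ n * μ (ball x r)) := by gcongr
      _ = _ := by rw [pow_succ']; ring

/-- A complete metric space carrying a doubling measure is proper. -/
theorem DoublingWith.properSpace [BorelSpace X] [CompleteSpace X] {μ : Measure X} {Cd : ℝ≥0}
    (hμ : DoublingWith μ Cd) : ProperSpace X := by
  refine .of_isCompact_closedBall_of_le 1 fun x R hR => ?_
  refine (isCompact_iff_totallyBounded_isComplete.2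
    ⟨Metric.totallyBounded_iff.2 fun ε hε => ?_, isClosed_closedBall.isComplete⟩)
  set δ : ℝ := min 1 (ε / 8) with hδ
  have hδ0 : 0 < δ := by positivity
  obtain ⟨u, hut, hdisj, hcov⟩ := Vitali.exists_disjoint_subfamily_covering_enlargement_closedBall
    (closedBall x R) (fun y : X => y) (fun _ => δ) δ (fun _ _ => le_rfl) 5 (by norm_num)
  obtain ⟨n, hn⟩ := pow_unbounded_of_one_lt (2 * (R + 2) / δ) (one_lt_two : (1 : ℝ) < 2)
  have hn' : 2 * (R + 2) ≤ 2 ^ n * δ := ((div_lt_iff₀ hδ0).1 hn).le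
  have hlow : ∀ y ∈ u, μ (ball x (R + 2)) / (Cd : ℝ≥0∞) ^ n ≤ μ (closedBall y δ) := by
    intro y hy
    refine ENNReal.div_le_of_le_mul' ?_
    calc μ (ball x (R + 2)) ≤ μ (ball y (2 ^ n * δ)) := by
          refine measure_mono (ball_subset_ball' ?_)
          have := mem_closedBall'.1 (hut hy)
          linarith
      _ ≤ (Cd : ℝ≥0∞) ^ n * μ (ball y δ) := hμ.measure_ball_two_pow_mul_le y hδ0 n
      _ ≤ _ := by gcongr; exact ball_subset_closedBall
  have hpos : 0 < μ (ball x (R + 2)) / (Cd : ℝ≥0∞) ^ n :=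
    ENNReal.div_pos (hμ x _ (by linarith)).1.ne' (by finiteness)
  have hfin : Set.Finite {i : u | μ (ball x (R + 2)) / (Cd : ℝ≥0∞) ^ n
      ≤ μ (closedBall (i : X) δ)} := by
    refine Measure.finite_const_le_meas_of_disjoint_iUnion μ hpos
      (fun i => isClosed_closedBall.measurableSet) (fun i j hij => ?_) ?_
    · exact hdisj i.2 j.2 (fun h => hij (Subtype.ext h))
    · refine ((measure_mono (iUnion_subset fun i => ?_)).trans_lt
        (hμ x (R + 2) (by linarith)).2.2).ne
      refine closedBall_subset_ball' ?_
      have := mem_closedBall.1 (hut i.2)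
      have : δ ≤ 1 := min_le_left _ _
      linarith
  have hufin : u.Finite := by
    have : Finite u := by
      rw [← Set.finite_univ_iff]
      exact hfin.subset fun i _ => hlow i i.2
    exact Set.toFinite u
  refine ⟨u, hufin, fun y hy => ?_⟩
  obtain ⟨b, hb, hsub⟩ := hcov y hy
  refine mem_iUnion₂.2 ⟨b, hb, ?_⟩
  have h1 := mem_closedBall.1 (hsub (mem_closedBall_self hδ0.le))
  have : δ ≤ ε / 8 := min_le_right _ _
  exact mem_ball.2 (by linarith)

/-- Around a point of measure-theoretic interior, at some scale below one where a set fills at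
most half of the ball, both the set and its complement fill a definite fraction of the ball. -/
theorem DoublingWith.exists_ball_balanced [BorelSpace X] {μ : Measure X} {Cd : ℝ≥0}
    (hCd : 1 ≤ Cd) (hμ : DoublingWith μ Cd) {G : Set X} (hG : MeasurableSet G) {y : X}
    (hy : y ∈ measInterior μ G) {s₀ : ℝ} (hs₀ : 0 < s₀)
    (h : 2 * μ (ball y s₀ ∩ G) ≤ μ (ball y s₀)) :
    ∃ s, 0 < s ∧ s ≤ s₀ ∧ μ (ball y s) ≤ 2 * Cd * μ (ball y s ∩ G) ∧
      μ (ball y s) ≤ 2 * Cd * μ (ball y s \ G) := by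
  have hCd' : (1 : ℝ≥0∞) ≤ Cd := by exact_mod_cast hCd
  let s : ℕ → ℝ := fun k => s₀ * (1 / 2) ^ k
  have hs : ∀ k, 0 < s k := fun k => by positivity
  have hlim : Tendsto s atTop (𝓝[>] 0) := by
    refine tendsto_nhdsWithin_iff.2 ⟨?_, .of_forall hs⟩
    simpa [s] using (tendsto_pow_atTop_nhds_zero_of_lt_one (r := (1 / 2 : ℝ)) (by norm_num)
      (by norm_num)).const_mul s₀
  have hsplit : ∀ k, μ (ball y (s k) ∩ G) + μ (ball y (s k) \ G) = μ (ball y (s k)) :=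
    fun k => measure_inter_add_sdiff _ hG
  have hfin : ∀ k, μ (ball y (s k)) ≠ ∞ := fun k => (hμ y _ (hs k)).2.2.ne
  have hex : ∃ k, ¬ 2 * μ (ball y (s k) ∩ G) ≤ μ (ball y (s k)) := by
    have h1 := (Tendsto.comp hy hlim).eventually (gt_mem_nhds (show (0 : ℝ≥0∞) < 2⁻¹ by simp))
    obtain ⟨k, hk⟩ := h1.exists
    refine ⟨k, fun hle => ?_⟩
    simp only [Function.comp] at hk
    have h2 : μ (ball y (s k) \ G) < 2⁻¹ * μ (ball y (s k)) :=
      (ENNReal.div_lt_iff (.inl (hμ y _ (hs k)).1.ne') (.inl (hfin k))).1 hk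
    have h3 : μ (ball y (s k) ∩ G) ≤ 2⁻¹ * μ (ball y (s k)) := by
      rw [mul_comm, ← div_eq_mul_inv, ENNReal.le_div_iff_mul_le (by simp) (by simp), mul_comm]
      exact hle
    have h4 := ENNReal.add_lt_add_of_le_of_lt
      (ne_top_of_le_ne_top (hfin k) (measure_mono inter_subset_left)) h3 h2
    rw [hsplit, ← add_mul, ENNReal.inv_two_add_inv_two, one_mul] at h4
    exact lt_irrefl _ h4
  classical
  obtain ⟨k, hk, hmin⟩ : ∃ k, 2 * μ (ball y (s k) ∩ G) ≤ μ (ball y (s k)) ∧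
      ¬ 2 * μ (ball y (s (k + 1)) ∩ G) ≤ μ (ball y (s (k + 1))) := by
    by_contra! hcon
    obtain ⟨k, hk⟩ := hex
    refine hk ?_
    clear hk
    induction k with
    | zero => simpa [s] using h
    | succ k ih => exact hcon k ih
  refine ⟨s k, hs k, ?_, ?_, ?_⟩
  · exact mul_le_of_le_one_right hs₀.le (pow_le_one₀ (by norm_num) (by norm_num))
  · have h2 : 2 * s (k + 1) = s k := by simp only [s, pow_succ]; ring
    calc μ (ball y (s k)) = μ (ball y (2 * s (k + 1))) := by rw [h2]
      _ ≤ Cd * μ (ball y (s (k + 1))) := (hμ y _ (hs _)).2.1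
      _ ≤ Cd * (2 * μ (ball y (s (k + 1)) ∩ G)) := by gcongr; exact (not_le.1 hmin).le
      _ ≤ Cd * (2 * μ (ball y (s k) ∩ G)) := by
          gcongr
          linarith [hs (k + 1)]
      _ = _ := by ring
  · have h5 : μ (ball y (s k) ∩ G) ≤ μ (ball y (s k) \ G) := by
      rw [← hsplit k, two_mul] at hk
      exact (ENNReal.add_le_add_iff_left
        (ne_top_of_le_ne_top (hfin k) (measure_mono inter_subset_left))).1 hk
    calc μ (ball y (s k)) ≤ 2 * μ (ball y (s k) \ G) := by
          rw [← hsplit k, two_mul]; gcongr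
      _ ≤ 2 * Cd * μ (ball y (s k) \ G) := by
          gcongr; exact le_mul_of_one_le_right (by simp) hCd'

/-- An upper gradient on an open set, restricted to a closed subset and set to `∞` elsewhere, is
an upper gradient of the truncated function on the whole space. -/
theorem IsUpperGradientOn.isUpperGradient_piecewise [BorelSpace X] {g : X → ℝ≥0∞} {v : X → ℝ}
    {Ω F : Set X} (hg : IsUpperGradientOn g v Ω) (hF : IsClosed F) (hFΩ : F ⊆ Ω)
    [DecidablePred (· ∈ F)] :
    IsUpperGradient (F.piecewise g fun _ => ∞) (F.indicator v) := by
  refine ⟨hg.1.piecewise hF.measurableSet measurable_const, fun ℓ hℓ γ hγ _ => ?_⟩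
  by_cases hin : ∀ t ∈ Icc (0 : ℝ) ℓ, γ t ∈ F
  · rw [indicator_of_mem (hin _ ⟨hℓ, le_rfl⟩), indicator_of_mem (hin _ ⟨le_rfl, hℓ⟩)]
    refine (hg.2 ℓ hℓ γ hγ fun t ht => hFΩ (hin t ht)).trans_eq ?_
    exact setLIntegral_congr_fun measurableSet_Icc fun t ht => by simp [hin t ht]
  · push Not at hin
    obtain ⟨t₀, ht₀, ht₀F⟩ := hin
    rcases hℓ.eq_or_lt with rfl | hℓ
    · simp
    · obtain ⟨U, hU, hUeq⟩ := continuousOn_iff'.1 hγ.continuousOn Fᶜ hF.isOpen_compl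
      have hsub : Ioo 0 ℓ ∩ U ⊆ γ ⁻¹' Fᶜ ∩ Icc 0 ℓ := by
        rw [hUeq]
        exact fun t ht => ⟨ht.2, Ioo_subset_Icc_self ht.1⟩
      have hpos : 0 < volume (Ioo 0 ℓ ∩ U) := by
        refine (isOpen_Ioo.inter hU).measure_pos volume ?_
        have hcl : t₀ ∈ closure (Ioo 0 ℓ) := by rwa [closure_Ioo hℓ.ne]
        rw [inter_comm]
        exact mem_closure_iff.1 hcl U hU (hUeq.subset ⟨ht₀F, ht₀⟩).1
      have htop : ∫⁻ t in Icc (0 : ℝ) ℓ, F.piecewise g (fun _ => ∞) (γ t) = ∞ := by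
        refine top_unique ?_
        calc (∞ : ℝ≥0∞) = ∫⁻ _ in Ioo 0 ℓ ∩ U, ∞ := by
              rw [setLIntegral_const, ENNReal.top_mul hpos.ne']
          _ = ∫⁻ t in Ioo 0 ℓ ∩ U, F.piecewise g (fun _ => ∞) (γ t) :=
              setLIntegral_congr_fun (isOpen_Ioo.inter hU).measurableSet fun t ht => by
                rw [piecewise_eq_of_notMem _ _ _ (hsub ht).1]
          _ ≤ _ := lintegral_mono_set fun t ht => (hsub ht).2
      rw [htop]
      exact le_top

/-- A Poincaré inequality bounds the smaller of the two portions into which a set divides a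
ball, through any function close to the characteristic function of the set. -/
theorem PoincareIneq.le_lintegral_add [BorelSpace X] [ProperSpace X] {μ : Measure X} {Cd : ℝ≥0}
    {CP lam : ℝ} (hlam : 1 ≤ lam) (hμ : DoublingWith μ Cd) (hP : PoincareIneq μ CP lam)
    {Ω : Set X} {y : X} {s : ℝ} (hs : 0 < s) (hΩ : closedBall y (lam * s) ⊆ Ω)
    {v : X → ℝ} {g : X → ℝ≥0∞} (hv : LocLipschitzOn v Ω) (hg : IsUpperGradientOn g v Ω)
    {G : Set X} (hG : MeasurableSet G) {m : ℝ≥0∞} (h₁ : m ≤ μ (ball y s ∩ G))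
    (h₂ : m ≤ μ (ball y s \ G)) :
    m ≤ (∫⁻ x in closedBall y (lam * s),
          ENNReal.ofReal |v x - G.indicator (fun _ => (1 : ℝ)) x| ∂μ) +
        ENNReal.ofReal (CP * s) * ∫⁻ x in ball y (lam * s), g x ∂μ := by
  classical
  set F := closedBall y (lam * s) with hFdef
  have hls : s ≤ lam * s := le_mul_of_one_le_left hs.le hlam
  have hBF : ball y s ⊆ F := (ball_subset_ball hls).trans ball_subset_closedBall
  have hFc : IsClosed F := isClosed_closedBall
  obtain ⟨L, hL⟩ := hv F hΩ (isCompact_closedBall _ _)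
  have hFfin : μ F < ∞ := by
    refine (measure_mono (closedBall_subset_ball (lt_add_one _))).trans_lt
      (hμ y (lam * s + 1) (by positivity)).2.2
  have humeas : Measurable (F.indicator v) := by
    rw [← piecewise_eq_indicator]
    exact hL.continuousOn.measurable_piecewise continuousOn_const hFc.measurableSet
  have huint : LocallyIntegrable (F.indicator v) μ := by
    refine Integrable.locallyIntegrable ?_
    obtain ⟨C, hC⟩ := (isCompact_closedBall y (lam * s)).exists_bound_of_continuousOn
      hL.continuousOn
    have : IntegrableOn (F.indicator v) F μ := by
      refine Measure.integrableOn_of_bounded hFfin.ne humeas.aestronglyMeasurable (M := C) ?_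
      filter_upwards [ae_restrict_mem hFc.measurableSet] with x hx
      rw [indicator_of_mem hx]
      exact hC x hx
    have h2 := (integrable_indicator_iff hFc.measurableSet).2 this
    rwa [indicator_indicator, inter_self] at h2
  have hPoin := hP y s hs _ _ huint (hg.isUpperGradient_piecewise hFc hΩ)
  set c := ⨍ z in ball y s, F.indicator v z ∂μ
  have hgeq : ∫⁻ x in ball y (lam * s), F.piecewise g (fun _ => ∞) x ∂μ
      = ∫⁻ x in ball y (lam * s), g x ∂μ :=
    setLIntegral_congr_fun measurableSet_ball fun x hx =>
      piecewise_eq_of_mem _ _ _ (ball_subset_closedBall hx)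
  rw [hgeq] at hPoin
  have hB := hμ y s hs
  have hB' := hμ y (lam * s) (by positivity)
  have hosc : ∫⁻ x in ball y s, ENNReal.ofReal |F.indicator v x - c| ∂μ ≤
      ENNReal.ofReal (CP * s) * ∫⁻ x in ball y (lam * s), g x ∂μ := by
    have h3 := (ENNReal.div_le_iff hB.1.ne' hB.2.2.ne).1 hPoin
    refine h3.trans ?_
    calc _ ≤ ENNReal.ofReal (CP * s) * ((∫⁻ x in ball y (lam * s), g x ∂μ)
          / μ (ball y (lam * s))) * μ (ball y (lam * s)) := by gcongr
      _ = _ := by rw [mul_assoc, ENNReal.div_mul_cancel hB'.1.ne' hB'.2.2.ne]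
  set χ : X → ℝ := G.indicator fun _ => (1 : ℝ)
  have hχ : Measurable χ := measurable_const.indicator hG
  calc m ≤ m * (ENNReal.ofReal |1 - c| + ENNReal.ofReal |0 - c|) := by
        refine le_mul_of_one_le_right (by simp) ?_
        rw [← ENNReal.ofReal_add (abs_nonneg _) (abs_nonneg _), ENNReal.one_le_ofReal]
        have := abs_sub_abs_le_abs_sub 1 c
        simp only [abs_one, zero_sub, abs_neg] at this ⊢
        linarith
    _ ≤ ENNReal.ofReal |1 - c| * μ (ball y s ∩ G) + ENNReal.ofReal |0 - c| * μ (ball y s \ G) := by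
        rw [mul_add, mul_comm m, mul_comm m]
        gcongr
    _ = ∫⁻ x in ball y s, ENNReal.ofReal |χ x - c| ∂μ := by
        rw [← lintegral_inter_add_sdiff _ (ball y s) hG, ← setLIntegral_const, ← setLIntegral_const]
        congr 1
        · exact setLIntegral_congr_fun (measurableSet_ball.inter hG) fun x hx => by
            simp [χ, hx.2]
        · exact setLIntegral_congr_fun (measurableSet_ball.diff hG) fun x hx => by
            simp [χ, hx.2]
    _ ≤ ∫⁻ x in ball y s, (ENNReal.ofReal |F.indicator v x - χ x|
          + ENNReal.ofReal |F.indicator v x - c|) ∂μ := by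
        refine lintegral_mono fun x => ?_
        rw [← ENNReal.ofReal_add (abs_nonneg _) (abs_nonneg _)]
        refine ENNReal.ofReal_le_ofReal ?_
        rw [abs_sub_comm (F.indicator v x) (χ x)]
        exact abs_sub_le _ _ _
    _ = (∫⁻ x in ball y s, ENNReal.ofReal |F.indicator v x - χ x| ∂μ)
          + ∫⁻ x in ball y s, ENNReal.ofReal |F.indicator v x - c| ∂μ :=
        lintegral_add_left (by fun_prop) _
    _ ≤ _ := by
        refine add_le_add ?_ hosc
        calc ∫⁻ x in ball y s, ENNReal.ofReal |F.indicator v x - χ x| ∂μ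
            ≤ ∫⁻ x in F, ENNReal.ofReal |F.indicator v x - χ x| ∂μ := lintegral_mono_set hBF
          _ = _ := setLIntegral_congr_fun hFc.measurableSet fun x hx => by
              simp [hx]

/-- A Lipschitz function vanishing off a closed set has its Lipschitz constant, restricted to that
set, as an upper gradient. -/
theorem isUpperGradient_indicator_of_lipschitzWith [BorelSpace X] {u : X → ℝ} {K : ℝ≥0}
    (hu : LipschitzWith K u) {F : Set X} (hF : IsClosed F) (hzero : ∀ x ∉ F, u x = 0) :
    IsUpperGradient (F.indicator fun _ => (K : ℝ≥0∞)) u := by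
  refine ⟨measurable_const.indicator hF.measurableSet, fun ℓ hℓ γ hγ _ => ?_⟩
  set f : ℝ → ℝ := u ∘ γ
  have hf : LipschitzOnWith K f (Icc 0 ℓ) := by
    simpa using hu.comp_lipschitzOnWith hγ
  set E : Set ℝ := Icc 0 ℓ ∩ γ ⁻¹' F
  have hE : MeasurableSet E :=
    (hγ.continuousOn.preimage_isClosed_of_isClosed isClosed_Icc hF).measurableSet
  have hsub : uIcc (f 0) (f ℓ) ⊆ f '' E ∪ {0} := by
    have hcont : ContinuousOn f (uIcc 0 ℓ) := by
      rw [uIcc_of_le hℓ]; exact hf.continuousOn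
    intro z hz
    obtain ⟨t, ht, rfl⟩ := intermediate_value_uIcc hcont hz
    rw [uIcc_of_le hℓ] at ht
    by_cases htF : γ t ∈ F
    · exact .inl ⟨t, ⟨ht, htF⟩, rfl⟩
    · exact .inr (hzero _ htF)
  calc ENNReal.ofReal |u (γ ℓ) - u (γ 0)| = volume (uIcc (f 0) (f ℓ)) := by
        rw [Real.volume_interval]; rfl
    _ ≤ volume (f '' E) + volume {(0 : ℝ)} := (measure_mono hsub).trans (measure_union_le _ _)
    _ = volume (f '' E) := by simp
    _ ≤ K * volume E := by
        have := (hf.mono (inter_subset_left : E ⊆ _)).hausdorffMeasure_image_le zero_le_one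
        simpa [hausdorffMeasure_real] using this
    _ = ∫⁻ t in E, F.indicator (fun _ => (K : ℝ≥0∞)) (γ t) := by
        rw [← setLIntegral_const]
        exact setLIntegral_congr_fun hE fun t ht => by
          rw [indicator_of_mem (show γ t ∈ F from ht.2)]
    _ ≤ _ := lintegral_mono_set inter_subset_left

/-- The sum of upper gradients of countably many functions with values in `[0, 1]` is an upper
gradient of their supremum. -/
theorem IsUpperGradient.iSup_tsum {ι : Type*} [Countable ι] {η : ι → X → ℝ} {g : ι → X → ℝ≥0∞}
    (h0 : ∀ j x, 0 ≤ η j x) (h1 : ∀ j x, η j x ≤ 1) (hg : ∀ j, IsUpperGradient (g j) (η j)) :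
    IsUpperGradient (fun x => ∑' j, g j x) (fun x => ⨆ j, η j x) := by
  refine ⟨Measurable.tsum fun j => (hg j).1, fun ℓ hℓ γ hγ hγΩ => ?_⟩
  set I := ∫⁻ t in Icc (0 : ℝ) ℓ, ∑' j, g j (γ t)
  have hI : ∀ j, ENNReal.ofReal |η j (γ ℓ) - η j (γ 0)| ≤ I := fun j =>
    ((hg j).2 ℓ hℓ γ hγ hγΩ).trans (lintegral_mono fun t => ENNReal.le_tsum j)
  rcases eq_or_ne I ∞ with htop | htop
  · rw [htop]; exact le_top
  have hI' : ∀ j, |η j (γ ℓ) - η j (γ 0)| ≤ I.toReal := fun j =>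
    (ENNReal.ofReal_le_iff_le_toReal htop).1 (hI j)
  have hbdd : ∀ x, BddAbove (range fun j => η j x) := fun x =>
    ⟨1, forall_mem_range.2 fun j => h1 j x⟩
  have hnn : ∀ x, 0 ≤ ⨆ j, η j x := fun x => Real.iSup_nonneg fun j => h0 j x
  rw [ENNReal.ofReal_le_iff_le_toReal htop, abs_sub_le_iff]
  constructor <;> rw [sub_le_iff_le_add] <;>
    refine Real.iSup_le (fun j => ?_) (add_nonneg ENNReal.toReal_nonneg (hnn _))
  · linarith [(abs_sub_le_iff.1 (hI' j)).1, le_ciSup (hbdd (γ 0)) j]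
  · linarith [(abs_sub_le_iff.1 (hI' j)).2, le_ciSup (hbdd (γ ℓ)) j]

/-- A plateau function on a ball: `1` on `closedBall y ρ`, `0` off `closedBall y (2 * ρ)`. -/
def plateau {Y : Type*} [PseudoMetricSpace Y] (y : Y) (ρ : ℝ) (x : Y) : ℝ :=
  max 0 (min 1 (2 - ρ⁻¹ * dist x y))

theorem plateau_nonneg {Y : Type*} [PseudoMetricSpace Y] (y : Y) (ρ : ℝ) (x : Y) : 0 ≤ plateau y ρ x := le_max_left _ _

theorem plateau_le_one {Y : Type*} [PseudoMetricSpace Y] (y : Y) (ρ : ℝ) (x : Y) : plateau y ρ x ≤ 1 :=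
  max_le zero_le_one (min_le_left _ _)

theorem one_le_plateau {Y : Type*} [PseudoMetricSpace Y] {y : Y} {ρ : ℝ} (hρ : 0 < ρ) {x : Y}
    (hx : x ∈ closedBall y ρ) :
    1 ≤ plateau y ρ x := by
  have : ρ⁻¹ * dist x y ≤ 1 := by
    rw [inv_mul_le_iff₀ hρ, mul_one]; exact hx
  exact le_max_of_le_right (le_min le_rfl (by linarith))

theorem plateau_eq_zero {Y : Type*} [PseudoMetricSpace Y] {y : Y} {ρ : ℝ} (hρ : 0 < ρ) {x : Y}
    (hx : x ∉ closedBall y (2 * ρ)) :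
    plateau y ρ x = 0 := by
  rw [mem_closedBall, not_le] at hx
  have : 2 ≤ ρ⁻¹ * dist x y := by
    rw [le_inv_mul_iff₀ hρ]; linarith
  exact max_eq_left (min_le_of_right_le (by linarith))

theorem lipschitzWith_plateau {Y : Type*} [PseudoMetricSpace Y] (y : Y) {ρ : ℝ} (hρ : 0 < ρ) :
    LipschitzWith ρ⁻¹.toNNReal (plateau y ρ) := by
  have h : LipschitzWith ρ⁻¹.toNNReal fun x => 2 - ρ⁻¹ * dist x y := by
    refine .of_dist_le_mul fun a b => ?_
    rw [Real.dist_eq, Real.coe_toNNReal _ (by positivity)]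
    rw [show 2 - ρ⁻¹ * dist a y - (2 - ρ⁻¹ * dist b y) = ρ⁻¹ * (dist b y - dist a y) by ring,
      abs_mul, abs_of_pos (inv_pos.2 hρ), dist_comm a b]
    gcongr
    exact abs_dist_sub_le _ _ _
  exact (h.const_min 1).const_max 0

/-- Fatou's lemma for sums. -/
theorem tsum_liminf_le {ι : Type*} (f : ℕ → ι → ℝ≥0∞) :
    ∑' j, atTop.liminf (fun i => f i j) ≤ atTop.liminf fun i => ∑' j, f i j := by
  let _ : MeasurableSpace ι := ⊤
  simpa only [lintegral_count] using
    lintegral_liminf_le (μ := Measure.count) (f := f) fun i => measurable_from_top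

/-- Lower semicontinuity form of the balanced Poincaré estimate: along a sequence converging in
`L¹` on compact sets to the characteristic function of a set occupying a definite fraction of the
ball and of its complement, the upper gradients do not vanish asymptotically. -/
theorem PoincareIneq.le_mul_liminf [BorelSpace X] [ProperSpace X] {μ : Measure X} {Cd : ℝ≥0}
    {CP lam : ℝ} (hCP : 0 < CP) (hlam : 1 ≤ lam) (hμ : DoublingWith μ Cd)
    (hP : PoincareIneq μ CP lam) {Ω : Set X} {y : X} {s : ℝ} (hs : 0 < s)
    (hΩ : closedBall y (lam * s) ⊆ Ω) {v : ℕ → X → ℝ} {g : ℕ → X → ℝ≥0∞} {G : Set X}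
    (hG : MeasurableSet G) (hv : ∀ i, LocLipschitzOn (v i) Ω)
    (hg : ∀ i, IsUpperGradientOn (g i) (v i) Ω)
    (hlim : ∀ K : Set X, K ⊆ Ω → IsCompact K → Tendsto (fun i => ∫⁻ x in K,
      ENNReal.ofReal |v i x - G.indicator (fun _ => (1 : ℝ)) x| ∂μ) atTop (𝓝 0))
    {m : ℝ≥0∞} (h₁ : m ≤ μ (ball y s ∩ G)) (h₂ : m ≤ μ (ball y s \ G)) :
    m ≤ ENNReal.ofReal (CP * s) *
      atTop.liminf fun i => ∫⁻ x in ball y (lam * s), g i x ∂μ := by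
  have hK : ENNReal.ofReal (CP * s) ≠ 0 := (ENNReal.ofReal_pos.2 (by positivity)).ne'
  have hm : m ≠ ∞ := ne_top_of_le_ne_top (hμ y s hs).2.2.ne
    (h₁.trans (measure_mono inter_subset_left))
  set e : ℕ → ℝ≥0∞ := fun i => ∫⁻ x in closedBall y (lam * s),
    ENNReal.ofReal |v i x - G.indicator (fun _ => (1 : ℝ)) x| ∂μ
  have he : Tendsto e atTop (𝓝 0) := hlim _ hΩ (isCompact_closedBall _ _)
  have hle : ∀ i, (m - e i) / ENNReal.ofReal (CP * s) ≤
      ∫⁻ x in ball y (lam * s), g i x ∂μ := fun i => by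
    refine ENNReal.div_le_of_le_mul' (tsub_le_iff_left.2 ?_)
    exact hP.le_lintegral_add hlam hμ hs hΩ (hv i) (hg i) hG h₁ h₂
  have ht : Tendsto (fun i => (m - e i) / ENNReal.ofReal (CP * s)) atTop
      (𝓝 ((m - 0) / ENNReal.ofReal (CP * s))) :=
    ENNReal.Tendsto.div_const (ENNReal.Tendsto.sub tendsto_const_nhds he (.inl hm)) (.inr hK)
  have := ht.liminf_eq.symm.trans_le (liminf_le_liminf (.of_forall hle))
  rw [tsub_zero, ENNReal.div_le_iff hK ENNReal.ofReal_ne_top, mul_comm] at this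
  exact this

/-- Capacity of a set covered by countably many balls well inside `Ω`. -/
theorem relCapacity1_le_tsum [BorelSpace X] {μ : Measure X} {A Ω : Set X} (hΩ : MeasurableSet Ω)
    (hΩfin : μ Ω ≠ ∞) {ι : Type*} [Countable ι] {c : ι → X} {ρ : ι → ℝ} (hρ : ∀ j, 0 < ρ j)
    (hA : A ⊆ ⋃ j, closedBall (c j) (ρ j)) (hsub : ∀ j, closedBall (c j) (2 * ρ j) ⊆ Ω) :
    relCapacity1 μ A Ω ≤ ∑' j, ENNReal.ofReal (ρ j)⁻¹ * μ (closedBall (c j) (2 * ρ j)) := by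
  set S := ∑' j, ENNReal.ofReal (ρ j)⁻¹ * μ (closedBall (c j) (2 * ρ j)) with hS
  rcases eq_or_ne S ∞ with htop | htop
  · rw [htop]; exact le_top
  set u : X → ℝ := fun x => ⨆ j, plateau (c j) (ρ j) x
  set g : X → ℝ≥0∞ := fun x => ∑' j, (closedBall (c j) (2 * ρ j)).indicator
    (fun _ => ((ρ j)⁻¹.toNNReal : ℝ≥0∞)) x
  have hg : IsUpperGradient g u := .iSup_tsum (fun j => plateau_nonneg _ _)
    (fun j => plateau_le_one _ _) fun j => isUpperGradient_indicator_of_lipschitzWith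
      (lipschitzWith_plateau _ (hρ j)) isClosed_closedBall fun x hx => plateau_eq_zero (hρ j) hx
  have hgint : ∫⁻ x, g x ∂μ = S := by
    rw [lintegral_tsum fun j =>
      (measurable_const.indicator isClosed_closedBall.measurableSet).aemeasurable]
    refine tsum_congr fun j => ?_
    rw [lintegral_indicator_const isClosed_closedBall.measurableSet]
    rfl
  have hnn : ∀ x, 0 ≤ u x := fun x => Real.iSup_nonneg fun j => plateau_nonneg _ _ _
  have hle : ∀ x, u x ≤ 1 := fun x => Real.iSup_le (fun j => plateau_le_one _ _ _) zero_le_one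
  have hzero : ∀ x, x ∉ Ω → u x = 0 := fun x hx => by
    simp only [u, fun j => plateau_eq_zero (hρ j) fun h => hx (hsub j h), Real.iSup_const_zero]
  have hone : ∀ x ∈ A, 1 ≤ u x := fun x hx => by
    obtain ⟨j, hj⟩ := mem_iUnion.1 (hA hx)
    exact (one_le_plateau (hρ j) hj).trans
      (le_ciSup (f := fun j => plateau (c j) (ρ j) x)
        ⟨1, forall_mem_range.2 fun j => plateau_le_one _ _ _⟩ j)
  have hmem : MemN11 μ u := by
    refine ⟨.iSup fun j => (lipschitzWith_plateau _ (hρ j)).continuous.measurable, ?_⟩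
    refine ENNReal.add_lt_top.2 ⟨?_, ?_⟩
    · calc eL1Norm μ u ≤ ∫⁻ x, Ω.indicator (fun _ => 1) x ∂μ := by
            refine lintegral_mono fun x => ?_
            by_cases hx : x ∈ Ω
            · rw [indicator_of_mem hx, ENNReal.ofReal_le_one, abs_of_nonneg (hnn x)]
              exact hle x
            · simp [hzero x hx]
        _ = μ Ω := by rw [lintegral_indicator_const hΩ, one_mul]
        _ < ∞ := hΩfin.lt_top
    · exact (iInf₂_le g hg).trans_lt (hgint.trans_lt htop.lt_top)
  calc relCapacity1 μ A Ω ≤ ∫⁻ x in Ω, g x ∂μ :=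
        iInf₂_le_of_le u hmem <| iInf₂_le_of_le g hg <| iInf₂_le_of_le hone hzero le_rfl
    _ ≤ ∫⁻ x, g x ∂μ := setLIntegral_le_lintegral _ _
    _ = S := hgint

/-- **Lemma (local boxing inequality).** There is a constant `C ≥ 1`, depending
only on `Cd`, `CP`, `lam`, such that if `G` is measurable with
`μ(G ∩ B(x,2r))/μ(B(x,2r)) ≤ 1/(2 Cd^⌈log₂(128 lam)⌉)`, then
`relcap₁(I_G ∩ B(x,r), B(x,2r)) ≤ C · P(G, B(x,2r))`. -/
theorem boxing_inequality
    (Cd : ℝ≥0) (CP lam : ℝ) (hCd : 1 ≤ Cd) (hCP : 0 < CP) (hlam : 1 ≤ lam) :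
    ∃ C : ℝ≥0, 1 ≤ C ∧
      ∀ (X : Type) [MetricSpace X] [CompleteSpace X] [Nontrivial X]
        [MeasurableSpace X] [BorelSpace X] (μ : Measure X),
        DoublingWith μ Cd → PoincareIneq μ CP lam →
        ∀ (x : X) (r : ℝ), 0 < r → ∀ G : Set X, MeasurableSet G →
          μ (G ∩ ball x (2 * r)) / μ (ball x (2 * r)) ≤
            1 / (2 * (Cd : ℝ≥0∞) ^ ⌈Real.logb 2 (128 * lam)⌉₊) →
          relCapacity1 μ (measInterior μ G ∩ ball x r) (ball x (2 * r)) ≤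
            (C : ℝ≥0∞) * perimeter μ G (ball x (2 * r)) := by
  refine ⟨1 + Cd ^ ⌈Real.logb 2 (128 * lam)⌉₊ * (2 * Cd * CP.toNNReal), le_self_add, ?_⟩
  intro X _ _ _ _ _ μ hμ hP x r hr G hG hdens
  have := hμ.properSpace
  set n := ⌈Real.logb 2 (128 * lam)⌉₊
  set Ω := ball x (2 * r)
  have hCd0 : (Cd : ℝ≥0∞) ≠ 0 := by
    simpa using (zero_lt_one.trans_le hCd).ne'
  have hn : 128 * lam ≤ 2 ^ n := by
    have h := (Real.logb_le_iff_le_rpow one_lt_two (by positivity)).1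
      (Nat.le_ceil (Real.logb 2 (128 * lam)))
    rwa [Real.rpow_natCast] at h
  set s₀ : ℝ := 4 * r / 2 ^ n
  have hs₀ : 0 < s₀ := by positivity
  have hs₀r : 32 * (lam * s₀) ≤ r := by
    have : 2 ^ n * s₀ = 4 * r := mul_div_cancel₀ _ (by positivity)
    nlinarith
  have hΩ : 0 < μ Ω ∧ μ Ω < ∞ := ⟨(hμ x _ (by positivity)).1, (hμ x _ (by positivity)).2.2⟩
  set A := measInterior μ G ∩ ball x r
  have hbal : ∀ y ∈ A, ∃ s, 0 < s ∧ s ≤ s₀ ∧ μ (ball y s) ≤ 2 * Cd * μ (ball y s ∩ G) ∧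
      μ (ball y s) ≤ 2 * Cd * μ (ball y s \ G) := by
    intro y hy
    refine hμ.exists_ball_balanced hCd hG hy.1 hs₀ ?_
    have hyx : dist y x < r := hy.2
    have hsmall : s₀ ≤ r := by nlinarith
    have hup : μ Ω ≤ (Cd : ℝ≥0∞) ^ n * μ (ball y s₀) := by
      refine (measure_mono (ball_subset_ball' ?_)).trans
        (hμ.measure_ball_two_pow_mul_le y hs₀ n)
      rw [mul_div_cancel₀ _ (by positivity), dist_comm]
      linarith
    rw [ENNReal.div_le_iff hΩ.1.ne' hΩ.2.ne] at hdens
    calc 2 * μ (ball y s₀ ∩ G) ≤ 2 * μ (G ∩ Ω) := by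
          rw [inter_comm]
          exact mul_le_mul_right (measure_mono
            (inter_subset_inter_right _ (ball_subset_ball' (by linarith)))) _
      _ ≤ 2 * (1 / (2 * (Cd : ℝ≥0∞) ^ n) * ((Cd : ℝ≥0∞) ^ n * μ (ball y s₀))) := by
          gcongr
          exact hdens.trans (by gcongr)
      _ = (2 * (Cd : ℝ≥0∞) ^ n) * (2 * (Cd : ℝ≥0∞) ^ n)⁻¹ * μ (ball y s₀) := by
          rw [one_div]; ring
      _ = μ (ball y s₀) := by
          rw [ENNReal.mul_inv_cancel (mul_ne_zero two_ne_zero (pow_ne_zero _ hCd0))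
            (by finiteness), one_mul]
  choose! s hs hss₀ hin hout using hbal
  obtain ⟨B, hBA, hdisj, hcov⟩ := Vitali.exists_disjoint_subfamily_covering_enlargement_closedBall
    A (fun y => y) (fun y => lam * s y) (lam * s₀)
    (fun y hy => mul_le_mul_of_nonneg_left (hss₀ y hy) (by positivity)) 5 (by norm_num)
  have hlams : ∀ y ∈ A, 32 * (lam * s y) ≤ r := fun y hy =>
    (by gcongr; exact hss₀ y hy : 32 * (lam * s y) ≤ 32 * (lam * s₀)).trans hs₀r
  have hsubΩ : ∀ y ∈ A, closedBall y (10 * (lam * s y)) ⊆ Ω := fun y hy => by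
    refine closedBall_subset_ball' ?_
    have h1 := hlams y hy
    have h2 : 0 < lam * s y := mul_pos (by linarith) (hs y hy)
    have h3 : dist y x < r := hy.2
    linarith
  have hsubΩ' : ∀ y ∈ A, closedBall y (lam * s y) ⊆ Ω := fun y hy =>
    (closedBall_subset_closedBall (by
      linarith [mul_pos (by linarith : 0 < lam) (hs y hy)])).trans (hsubΩ y hy)
  have hpw : Pairwise (Function.onFun Disjoint fun j : B => closedBall (j : X) (lam * s j)) :=
    fun i j hij => hdisj i.2 j.2 fun h => hij (Subtype.ext h)
  have hcount : Countable B := by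
    have h := Measure.countable_meas_pos_of_disjoint_of_meas_iUnion_ne_top μ
      (As := fun j : B => closedBall (j : X) (lam * s j))
      (fun j => isClosed_closedBall.measurableSet) hpw
      (ne_top_of_le_ne_top hΩ.2.ne (measure_mono (iUnion_subset fun j => hsubΩ' j (hBA j.2))))
    rw [← Set.countable_univ_iff]
    refine h.mono fun j _ => ?_
    exact (hμ j (lam * s j) (mul_pos (by linarith) (hs j (hBA j.2)))).1.trans_le
      (measure_mono ball_subset_closedBall)
  have hcap := relCapacity1_le_tsum (μ := μ) (A := A) (Ω := Ω) measurableSet_ball hΩ.2.ne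
    (ι := B) (c := fun j => (j : X)) (ρ := fun j => 5 * (lam * s j))
    (fun j => mul_pos (by norm_num) (mul_pos (by linarith) (hs j (hBA j.2))))
    (fun y hy => by
      obtain ⟨b, hb, hsub⟩ := hcov y hy
      exact mem_iUnion.2 ⟨⟨b, hb⟩, hsub (mem_closedBall_self
        (mul_pos (by linarith) (hs y hy)).le)⟩)
    (fun j => by rw [← mul_assoc]; norm_num; exact hsubΩ j (hBA j.2))
  set D : ℝ≥0 := 1 + Cd ^ n * (2 * Cd * CP.toNNReal)
  have hD : (D : ℝ≥0∞) ≠ 0 := by simp [D]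
  suffices h : relCapacity1 μ A Ω / D ≤ perimeter μ G Ω by
    rwa [ENNReal.div_le_iff' hD ENNReal.coe_ne_top] at h
  refine le_iInf₂ fun v g => le_iInf₂ fun hv hg => le_iInf fun hlim => ?_
  refine ENNReal.div_le_of_le_mul' (hcap.trans ?_)
  have hterm : ∀ j : B, ENNReal.ofReal (5 * (lam * s j))⁻¹ *
      μ (closedBall (j : X) (2 * (5 * (lam * s j)))) ≤
      D * atTop.liminf fun i => ∫⁻ z in ball (j : X) (lam * s j), g i z ∂μ := by
    intro j
    have hjA := hBA j.2
    have hsj := hs j hjA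
    set L := atTop.liminf fun i => ∫⁻ z in ball (j : X) (lam * s j), g i z ∂μ
    have h2Cd : (2 * Cd : ℝ≥0∞) ≠ 0 := mul_ne_zero two_ne_zero hCd0
    have hbd := hP.le_mul_liminf hCP hlam hμ hsj (hsubΩ' j hjA) hG hv hg hlim
      (m := μ (ball (j : X) (s j)) / (2 * Cd))
      (ENNReal.div_le_of_le_mul' (hin j hjA)) (ENNReal.div_le_of_le_mul' (hout j hjA))
    rw [ENNReal.div_le_iff h2Cd (by finiteness)] at hbd
    have hrho : (5 * (lam * s j))⁻¹ ≤ (s j)⁻¹ := by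
      gcongr
      nlinarith
    have hvol : μ (closedBall (j : X) (2 * (5 * (lam * s j)))) ≤
        (Cd : ℝ≥0∞) ^ n * μ (ball (j : X) (s j)) := by
      refine (measure_mono (closedBall_subset_ball ?_)).trans
        (hμ.measure_ball_two_pow_mul_le (j : X) hsj n)
      nlinarith
    have hcancel : ENNReal.ofReal (s j)⁻¹ * ENNReal.ofReal (CP * s j) = CP.toNNReal := by
      rw [← ENNReal.ofReal_mul (by positivity), mul_comm CP, inv_mul_cancel_left₀ hsj.ne']
      rfl
    calc _ ≤ ENNReal.ofReal (s j)⁻¹ * ((Cd : ℝ≥0∞) ^ n *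
            (ENNReal.ofReal (CP * s j) * L * (2 * Cd))) := by
          gcongr
          exact hvol.trans (by gcongr)
      _ = (Cd : ℝ≥0∞) ^ n * (2 * Cd *
            (ENNReal.ofReal (s j)⁻¹ * ENNReal.ofReal (CP * s j))) * L := by ring
      _ ≤ D * L := by
          rw [hcancel]
          gcongr
          simp [D]
  calc _ ≤ ∑' j : B, D * atTop.liminf fun i => ∫⁻ z in ball (j : X) (lam * s j), g i z ∂μ :=
        ENNReal.tsum_le_tsum hterm
    _ = D * ∑' j : B, atTop.liminf fun i => ∫⁻ z in ball (j : X) (lam * s j), g i z ∂μ :=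
        ENNReal.tsum_mul_left
    _ ≤ D * atTop.liminf fun i => ∑' j : B, ∫⁻ z in ball (j : X) (lam * s j), g i z ∂μ := by
        gcongr
        exact tsum_liminf_le _
    _ ≤ _ := by
        gcongr
        refine liminf_le_liminf (.of_forall fun i => ?_)
        rw [← lintegral_iUnion (fun j : B => measurableSet_ball) fun i j hij =>
          (hpw hij).mono ball_subset_closedBall ball_subset_closedBall]
        exact lintegral_mono_set (iUnion_subset fun j =>
          ball_subset_closedBall.trans (hsubΩ' j (hBA j.2)))

end FineBV
end
end
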